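/- arXiv:1503.05114 — 2 statements merged into one kernel-verified Lean document; each statement's English description precedes it below -/
import Mathlib

section
/- Let k be a field of characteristic p (p prime) and work in p+1 variables, i.e., in Sym_{p+1} ⊂ k[x_0,…,x_p]. Let B = k[e_p^p] be the k-subalgebra generated by e_p^p (note ∂ vanishes on B). Then: (i) the inclusion B ↪ Sym_{p+1} is a quasi-isomorphism of p-complexes, i.e., for every s with 1 ≤ s ≤ p−1: every f ∈ Sym_{p+1} with ∂^s f = 0 can be written f = g + ∂^{p−s}(h) with g ∈ B and h ∈ Sym_{p+1}, and the only element of B lying in ∂^{p−s}(Sym_{p+1}) is 0. (ii) The rank-one twisted p-complex (Sym_{p+1}, D_1), where D_1(f) = ∂(f) + e_1·f, is acyclic: for every s with 1 ≤ s ≤ p−1, {f ∈ Sym_{p+1} : D_1^s f = 0} = D_1^{p−s}(Sym_{p+1}). -/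
open MvPolynomial

section PComplex

variable {k V : Type*} [Field k] [AddCommGroup V] [Module k V]

/-- If `[D, T] = L` with `L` commuting with `D` and `T`, then `D ^ j * T ^ j` acts on `ker D` as
`j! • L ^ j`. -/
lemma pow_apply_pow_apply_of_commutator {D T L : Module.End k V} (h : D * T = T * D + L)
    (hT : Commute L T) (hD : Commute L D) (j : ℕ) {f : V} (hf : D f = 0) :
    (D ^ j) ((T ^ j) f) = (j.factorial : k) • (L ^ j) f := by
  have key (m : ℕ) : D * T ^ m = T ^ m * D + (m : k) • (T ^ (m - 1) * L) := by
    induction m with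
    | zero => simp
    | succ m ih =>
      rcases m with _ | m
      · simp [h]
      · rw [pow_succ T (m + 1), ← mul_assoc, ih, add_mul, mul_assoc, h, smul_mul_assoc, mul_assoc,
          hT.eq, ← mul_assoc (T ^ (m + 1 - 1)), Nat.add_sub_cancel, ← pow_succ,
          Nat.add_sub_cancel, mul_add, mul_assoc, add_assoc]
        congr 1
        push_cast
        module
  induction j generalizing f with
  | zero => simp
  | succ j ih =>
    have hLf : D (L f) = 0 := by
      have := congrArg (· f) hD.eq
      simp only [Module.End.mul_apply, hf, map_zero] at this
      exact this.symm
    have h1 : D ((T ^ (j + 1)) f) = ((j + 1 : ℕ) : k) • (T ^ j) (L f) := by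
      have := congrArg (· f) (key (j + 1))
      simpa [hf] using this
    rw [pow_succ D, Module.End.mul_apply, h1, map_smul, ih hLf, smul_smul, pow_succ L,
      Module.End.mul_apply, Nat.factorial_succ]
    push_cast
    rfl

variable {p : ℕ}

lemma factorial_pred_ne_zero (hp : p.Prime) [CharP k p] : ((p - 1).factorial : k) ≠ 0 := by
  rw [Ne, CharP.cast_eq_zero_iff k p, hp.dvd_factorial]
  have := hp.pos
  omega

/-- A scalar commutator `[D, T] = c ≠ 0` contracts `ker D` onto `im D ^ (p - 1)`. -/
lemma eq_pow_apply_of_commutator_smul_one (hp : p.Prime) [CharP k p] {D T : Module.End k V} {c : k}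
    (hc : c ≠ 0) (h : D * T = T * D + c • 1) {f : V} (hf : D f = 0) :
    f = (D ^ (p - 1)) ((((p - 1).factorial : k) * c ^ (p - 1))⁻¹ • (T ^ (p - 1)) f) := by
  have := pow_apply_pow_apply_of_commutator h ((Commute.one_left T).smul_left c)
    ((Commute.one_left D).smul_left c) (p - 1) hf
  have hne := mul_ne_zero (factorial_pred_ne_zero (k := k) hp) (pow_ne_zero (p - 1) hc)
  rw [map_smul, this, smul_pow, one_pow, LinearMap.smul_apply, Module.End.one_apply,
    smul_smul _ (c ^ (p - 1)), smul_smul, inv_mul_cancel₀ hne, one_smul]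

/-- If `ker D ⊆ B + im D ^ (p - 1)` and `B ∩ im D = 0`, then `ker D ^ s ⊆ B + im D ^ (p - s)`. -/
lemma exists_eq_add_pow_apply {D : Module.End k V} {B : Set V}
    (h1 : ∀ f, D f = 0 → ∃ g ∈ B, ∃ h, f = g + (D ^ (p - 1)) h)
    (h2 : ∀ g ∈ B, ∀ h, D h = g → g = 0) (s : ℕ) (hs : 1 ≤ s) (hsp : s ≤ p - 1) (f : V)
    (hf : (D ^ s) f = 0) : ∃ g ∈ B, ∃ h, f = g + (D ^ (p - s)) h := by
  induction s, hs using Nat.le_induction generalizing f with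
  | base => exact h1 f (by simpa using hf)
  | succ s hs ih =>
    obtain ⟨g, hg, h, hgh⟩ := h1 ((D ^ s) f) (by rwa [← Module.End.mul_apply, ← pow_succ'])
    have hg0 : g = 0 := by
      refine h2 g hg ((D ^ (s - 1)) f - (D ^ (p - 2)) h) ?_
      rw [map_sub, ← Module.End.mul_apply, ← Module.End.mul_apply, ← pow_succ', ← pow_succ',
        show s - 1 + 1 = s by omega, show p - 2 + 1 = p - 1 by omega, hgh, add_sub_cancel_right]
    obtain ⟨g', hg', h', hgh'⟩ := ih (by omega) (f - (D ^ (p - (s + 1))) h) (by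
      rw [map_sub, ← Module.End.mul_apply, ← pow_add, show s + (p - (s + 1)) = p - 1 by omega, hgh,
        hg0, zero_add, sub_self])
    refine ⟨g', hg', h + D h', ?_⟩
    rw [map_add, ← Module.End.mul_apply, ← pow_succ, show p - (s + 1) + 1 = p - s by omega,
      add_left_comm, ← hgh', add_sub_cancel]

end PComplex

section Ladder

variable {k σ : Type*} [Field k]

/-- The operator `x ^ m ↦ c (m i) x ^ (m + e_i)`. -/
noncomputable def raise (c : ℕ → k) (i : σ) : Module.End k (MvPolynomial σ k) :=
  (basisMonomials σ k).constr k fun m => monomial (m + Finsupp.single i 1) (c (m i))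

/-- The operator `x ^ m ↦ d (m i) x ^ (m - e_i)`. -/
noncomputable def lower (d : ℕ → k) (i : σ) : Module.End k (MvPolynomial σ k) :=
  (basisMonomials σ k).constr k fun m => monomial (m - Finsupp.single i 1) (d (m i))

/-- The operator `x ^ m ↦ l (m i) x ^ m`. -/
noncomputable def diag (l : ℕ → k) (i : σ) : Module.End k (MvPolynomial σ k) :=
  (basisMonomials σ k).constr k fun m => monomial m (l (m i))

lemma constr_monomial (F : (σ →₀ ℕ) → MvPolynomial σ k) (m : σ →₀ ℕ) (r : k) :
    (basisMonomials σ k).constr k F (monomial m r) = r • F m := by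
  have h : monomial m r = r • basisMonomials σ k m := by simp [smul_monomial]
  rw [h, map_smul, Module.Basis.constr_basis]

@[simp]
lemma raise_monomial (c : ℕ → k) (i : σ) (m : σ →₀ ℕ) (r : k) :
    raise c i (monomial m r) = monomial (m + Finsupp.single i 1) (r * c (m i)) := by
  rw [raise, constr_monomial, smul_monomial, smul_eq_mul]

@[simp]
lemma lower_monomial (d : ℕ → k) (i : σ) (m : σ →₀ ℕ) (r : k) :
    lower d i (monomial m r) = monomial (m - Finsupp.single i 1) (r * d (m i)) := by
  rw [lower, constr_monomial, smul_monomial, smul_eq_mul]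

@[simp]
lemma diag_monomial (l : ℕ → k) (i : σ) (m : σ →₀ ℕ) (r : k) :
    diag l i (monomial m r) = monomial m (r * l (m i)) := by
  rw [diag, constr_monomial, smul_monomial, smul_eq_mul]

lemma end_ext {F G : Module.End k (MvPolynomial σ k)}
    (h : ∀ m, F (monomial m 1) = G (monomial m 1)) : F = G :=
  (basisMonomials σ k).ext fun m => by simpa using h m

lemma raise_mul_lower_of_ne (c d : ℕ → k) {i j : σ} (hij : i ≠ j) :
    raise c i * lower d j = lower d j * raise c i := by
  refine end_ext fun m => ?_
  classical
  simp only [Module.End.mul_apply, raise_monomial, lower_monomial, Finsupp.coe_add,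
    Finsupp.coe_tsub, Pi.add_apply, Pi.sub_apply, Finsupp.single_apply, if_neg hij,
    if_neg hij.symm, add_zero, tsub_zero, one_mul, mul_comm]
  congr 2
  ext a
  simp only [Finsupp.coe_add, Finsupp.coe_tsub, Pi.add_apply, Pi.sub_apply, Finsupp.single_apply]
  by_cases h1 : i = a <;> by_cases h2 : j = a <;> simp_all

lemma raise_mul_lower_self {c d l : ℕ → k} (hd : d 0 = 0)
    (h : ∀ a, d a * c (a - 1) = c a * d (a + 1) + l a) (i : σ) :
    raise c i * lower d i = lower d i * raise c i + diag l i := by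
  refine end_ext fun m => ?_
  simp only [Module.End.mul_apply, LinearMap.add_apply, raise_monomial, lower_monomial,
    diag_monomial, Finsupp.coe_add, Finsupp.coe_tsub, Pi.add_apply, Pi.sub_apply,
    Finsupp.single_eq_same, one_mul, add_tsub_cancel_right, ← map_add, h]
  by_cases h0 : m i = 0
  · rw [← h, h0, hd, zero_mul, map_zero, map_zero]
  · rw [tsub_add_cancel_of_le (by simpa [Nat.one_le_iff_ne_zero] using h0)]

lemma rename_lower (d : ℕ → k) (i : σ) (e : Equiv.Perm σ) (f : MvPolynomial σ k) :
    rename e (lower d i f) = lower d (e i) (rename e f) := by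
  suffices h : (rename e).toLinearMap ∘ₗ lower d i = lower d (e i) ∘ₗ
      (rename (R := k) e).toLinearMap from congrArg (· f) h
  refine (basisMonomials σ k).ext fun m => ?_
  have h1 : Finsupp.mapDomain e m (e i) = m i := Finsupp.mapDomain_apply e.injective m i
  simp only [coe_basisMonomials, LinearMap.comp_apply, AlgHom.toLinearMap_apply, lower_monomial,
    rename_monomial, h1]
  congr 2
  ext a
  obtain ⟨b, rfl⟩ := e.surjective a
  classical
  simp [Finsupp.mapDomain_apply e.injective, Finsupp.single_apply]

lemma raise_pow_monomial (c : ℕ → k) (i : σ) (m : σ →₀ ℕ) (r : ℕ) :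
    (raise c i ^ r) (monomial m 1) =
      monomial (m + Finsupp.single i r) (∏ t ∈ Finset.range r, c (m i + t)) := by
  induction r with
  | zero => simp
  | succ r ih =>
    rw [pow_succ', Module.End.mul_apply, ih, raise_monomial, Finset.prod_range_succ, add_assoc,
      ← Finsupp.single_add]
    simp

lemma raise_commute (c : ℕ → k) (i j : σ) : Commute (raise c i) (raise c j) := by
  by_cases hij : i = j
  · rw [hij]
  refine end_ext fun m => ?_
  classical
  simp [hij, Ne.symm hij, add_right_comm, mul_comm]

lemma neg_natCast_pow_char_sub_one {p : ℕ} (hp : p.Prime) [CharP k p] {c : ℕ} (hc : c ≠ 0)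
    (hcp : c < p) : (-(c : k)) ^ (p - 1) = 1 := by
  have : Fact p.Prime := ⟨hp⟩
  have hne : -(c : k) ≠ 0 := by
    rw [neg_ne_zero, Ne, CharP.cast_eq_zero_iff k p]
    exact Nat.not_dvd_of_pos_of_lt (Nat.pos_of_ne_zero hc) hcp
  have h : (-(c : k)) ^ p = -(c : k) := by
    rw [← frobenius_def, map_neg, map_natCast]
  refine mul_right_cancel₀ hne ?_
  rw [← pow_succ, Nat.sub_add_cancel hp.one_le, h, one_mul]

variable [Fintype σ]

lemma sum_raise_pow_char {p : ℕ} (hp : p.Prime) [CharP k p] {c : ℕ → k}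
    (hc : ∀ a, ∏ t ∈ Finset.range p, c (a + t) = 0) : (∑ i : σ, raise c i) ^ p = 0 := by
  have : Fact p.Prime := ⟨hp⟩
  have : CharP (Module.End k (MvPolynomial σ k)) p :=
    charP_of_injective_algebraMap (FaithfulSMul.algebraMap_injective k _) p
  have : ExpChar (Module.End k (MvPolynomial σ k)) p := .prime hp
  classical
  have key (s : Finset σ) : (∑ i ∈ s, raise c i) ^ p = 0 := by
    induction s using Finset.induction_on with
    | empty => simp [hp.ne_zero]
    | insert i s hi ih =>
      rw [Finset.sum_insert hi,
        add_pow_char_of_commute (p := p) (Commute.sum_right _ _ _ fun j _ => raise_commute c i j), ih,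
        add_zero]
      refine end_ext fun m => ?_
      rw [raise_pow_monomial, hc]
      simp
  exact key _

lemma sum_raise_mul_sum_lower {c d l : ℕ → k} (hd : d 0 = 0)
    (h : ∀ a, d a * c (a - 1) = c a * d (a + 1) + l a) :
    (∑ i : σ, raise c i) * (∑ i : σ, lower d i) =
      (∑ i : σ, lower d i) * (∑ i : σ, raise c i) + ∑ i : σ, diag l i := by
  classical
  rw [Finset.sum_mul_sum, Finset.sum_mul_sum, Finset.sum_comm, ← Finset.sum_add_distrib]
  refine Finset.sum_congr rfl fun j _ => ?_
  have (i : σ) : raise c i * lower d j = lower d j * raise c i + if i = j then diag l j else 0 := by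
    split_ifs with hij
    · rw [hij, raise_mul_lower_self hd h]
    · rw [raise_mul_lower_of_ne c d hij, add_zero]
  simp [this, Finset.sum_add_distrib]

lemma isSymmetric_sum_lower_pow (d : ℕ → k) (r : ℕ) {f : MvPolynomial σ k} (hf : f.IsSymmetric) :
    (((∑ i : σ, lower d i) ^ r) f).IsSymmetric := by
  induction r with
  | zero => simpa
  | succ r ih =>
    rw [pow_succ', Module.End.mul_apply]
    intro e
    rw [LinearMap.sum_apply, map_sum]
    simp_rw [rename_lower, ih e]
    exact Equiv.sum_comp e fun i => lower d i (((∑ i : σ, lower d i) ^ r) f)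

/-- In a number of variables prime to `p`, the operator `∑ (x_i ^ 2 ∂_i + x_i)` is acyclic on
symmetric polynomials. -/
lemma exists_symmetric_eq_sum_raise_succ_pow {p : ℕ} (hp : p.Prime) [CharP k p]
    (hσ : (Fintype.card σ : k) ≠ 0) {f : MvPolynomial σ k} (hf : f.IsSymmetric)
    (hDf : (∑ i : σ, raise (fun a => (a : k) + 1) i) f = 0) :
    ∃ h : MvPolynomial σ k, h.IsSymmetric ∧
      f = ((∑ i : σ, raise (fun a => (a : k) + 1) i) ^ (p - 1)) h := by
  have hcomm := sum_raise_mul_sum_lower (σ := σ) (c := fun a => (a : k) + 1)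
    (d := fun a => if a = 0 then 0 else 1) (l := fun _ => -1) (by simp) (by
      rintro (_ | a) <;> simp)
  have hL : ∑ i : σ, diag (fun _ => (-1 : k)) i = (-(Fintype.card σ : k)) • 1 := by
    refine end_ext fun m => ?_
    simp only [LinearMap.sum_apply, diag_monomial, LinearMap.smul_apply, Module.End.one_apply,
      smul_monomial, Finset.sum_const, Finset.card_univ]
    simp
  rw [hL] at hcomm
  exact ⟨_, (isSymmetric_sum_lower_pow _ _ hf).smul _,
    eq_pow_apply_of_commutator_smul_one hp (neg_ne_zero.mpr hσ) hcomm hDf⟩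

/-- In fewer than `p` variables, the operator `∑ x_i ^ 2 ∂_i` on symmetric polynomials has only
the constants as cohomology. -/
lemma exists_symmetric_eq_C_add_sum_raise_pow {p : ℕ} (hp : p.Prime) [CharP k p]
    (hσ : Fintype.card σ < p) {f : MvPolynomial σ k} (hf : f.IsSymmetric)
    (hDf : (∑ i : σ, raise (fun a => (a : k)) i) f = 0) :
    ∃ (r : k) (h : MvPolynomial σ k), h.IsSymmetric ∧
      f = C r + ((∑ i : σ, raise (fun a => (a : k)) i) ^ (p - 1)) h := by
  set D : Module.End k (MvPolynomial σ k) := ∑ i : σ, raise (fun a => (a : k)) i with hDdef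
  set T : Module.End k (MvPolynomial σ k) :=
    ∑ i : σ, lower (fun a => if a ≤ 1 then 0 else 1) i with hTdef
  set L : Module.End k (MvPolynomial σ k) :=
    ∑ i : σ, diag (fun a => if a = 0 then 0 else -1) i with hLdef
  have hcomm : D * T = T * D + L := sum_raise_mul_sum_lower (by simp) (by
      rintro (_ | _ | a) <;> simp)
  have hL (m : σ →₀ ℕ) (r : k) : L (monomial m r) = (-(m.support.card : k)) • monomial m r := by
    simp only [hLdef, LinearMap.sum_apply, diag_monomial, ← map_sum, smul_monomial]
    congr 1
    rw [← Finset.mul_sum, smul_eq_mul, mul_comm r]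
    congr 1
    rw [Finset.card_eq_sum_ones, Nat.cast_sum, ← Finset.sum_neg_distrib]
    rw [← Finset.sum_subset (Finset.subset_univ m.support) fun i _ hi => by simp_all]
    exact Finset.sum_congr rfl fun i hi => by simp_all
  have hLD : Commute L D := by
    refine end_ext fun m => ?_
    simp only [Module.End.mul_apply, hL, map_smul]
    have hDm : D (monomial m 1) = ∑ i : σ, raise (fun a => (a : k)) i (monomial m 1) :=
      LinearMap.sum_apply _ _ _
    rw [hDm, map_sum L, Finset.smul_sum]
    refine Finset.sum_congr rfl fun i _ => ?_
    rw [raise_monomial, hL]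
    by_cases h0 : m i = 0
    · simp [h0]
    · congr 4
      ext j
      by_cases hj : i = j
      · subst hj; simp [h0]
      · simp [hj]
  have hLT : Commute L T := by
    refine end_ext fun m => ?_
    simp only [Module.End.mul_apply, hL, map_smul]
    have hTm : T (monomial m 1) = ∑ i : σ, lower (fun a => if a ≤ 1 then 0 else 1) i (monomial m 1) :=
      LinearMap.sum_apply _ _ _
    rw [hTm, map_sum L, Finset.smul_sum]
    refine Finset.sum_congr rfl fun i _ => ?_
    rw [lower_monomial, hL]
    by_cases h0 : m i ≤ 1
    · simp [h0]
    · congr 4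
      ext j
      by_cases hj : i = j
      · subst hj; simp; omega
      · simp [hj]
  have hLpow (j : ℕ) (m : σ →₀ ℕ) (r : k) :
      (L ^ j) (monomial m r) = (-(m.support.card : k)) ^ j • monomial m r := by
    induction j with
    | zero => simp
    | succ j ih => rw [pow_succ', Module.End.mul_apply, ih, map_smul, hL, smul_smul, pow_succ]
  have hFermat : (L ^ (p - 1)) f = f - C (coeff 0 f) := by
    have hlin : L ^ (p - 1) = 1 - (Algebra.linearMap k (MvPolynomial σ k)) ∘ₗ lcoeff k 0 := by
      refine end_ext fun m => ?_
      rw [hLpow]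
      rcases eq_or_ne m 0 with rfl | h0
      · have := hp.two_le
        simp [lcoeff, show p - 1 ≠ 0 by omega]
      · have hpos : m.support.card ≠ 0 := by simpa using h0
        have hlt : m.support.card < p := (Finset.card_le_univ _).trans_lt hσ
        rw [neg_natCast_pow_char_sub_one hp hpos hlt]
        classical simp [lcoeff, coeff_monomial, h0]
    rw [hlin]
    simp [lcoeff]
  have hmain := pow_apply_pow_apply_of_commutator hcomm hLT hLD (p - 1) hDf
  refine ⟨coeff 0 f, ((p - 1).factorial : k)⁻¹ • (T ^ (p - 1)) f,
    (isSymmetric_sum_lower_pow _ _ hf).smul _, ?_⟩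
  rw [map_smul, hmain, smul_smul, inv_mul_cancel₀ (factorial_pred_ne_zero hp), one_smul, hFermat,
    add_sub_cancel]

end Ladder

section Elementary

variable {k σ : Type*} [Field k] [Fintype σ]

lemma derivation_esymm (D : Derivation k (MvPolynomial σ k) (MvPolynomial σ k))
    (hD : ∀ i, D (X i) = X i ^ 2) (j : ℕ) :
    D (esymm σ k j) = esymm σ k 1 * esymm σ k j - ((j : k) + 1) • esymm σ k (j + 1) := by
  classical
  have hone (s : Finset σ) :
      ∑ t ∈ s.powersetCard 1, ∏ i ∈ t, (X i : MvPolynomial σ k) = ∑ i ∈ s, X i := by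
    rw [Finset.powersetCard_one, Finset.sum_map]
    simp
  have key (s : Finset σ) (j : ℕ) :
      D (∑ t ∈ s.powersetCard j, ∏ i ∈ t, X i) =
        (∑ i ∈ s, X i) * (∑ t ∈ s.powersetCard j, ∏ i ∈ t, X i) -
          ((j : k) + 1) • ∑ t ∈ s.powersetCard (j + 1), ∏ i ∈ t, X i := by
    induction s using Finset.induction_on generalizing j with
    | empty =>
      rcases j with _ | j
      · simp [hone]
      · have hempty (j : ℕ) : (∅ : Finset σ).powersetCard (j + 1) = ∅ := by
          rw [Finset.powersetCard_eq_empty]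
          simp
        simp [hempty]
    | insert i s hi ih =>
      have hrec (j : ℕ) : ∑ t ∈ (insert i s).powersetCard (j + 1), ∏ i ∈ t, X i =
          ∑ t ∈ s.powersetCard (j + 1), ∏ i ∈ t, X i +
            X i * ∑ t ∈ s.powersetCard j, ∏ i ∈ t, (X i : MvPolynomial σ k) := by
        rw [Finset.powersetCard_succ_insert hi, Finset.sum_union, Finset.sum_image, Finset.mul_sum]
        · congr 1
          refine Finset.sum_congr rfl fun t ht => Finset.prod_insert fun h => hi ?_
          exact (Finset.mem_powersetCard.mp ht).1 h
        · intro t ht u hu htu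
          have ht' : i ∉ t := fun h => hi ((Finset.mem_powersetCard.mp ht).1 h)
          have hu' : i ∉ u := fun h => hi ((Finset.mem_powersetCard.mp hu).1 h)
          rw [← Finset.erase_insert ht', htu, Finset.erase_insert hu']
        · rw [Finset.disjoint_left]
          intro t ht ht'
          obtain ⟨u, -, rfl⟩ := Finset.mem_image.mp ht'
          exact hi ((Finset.mem_powersetCard.mp ht).1 (Finset.mem_insert_self i u))
      rcases j with _ | j
      · simp [hone]
      · rw [hrec, hrec, map_add, D.leibniz, ih, ih, hD, Finset.sum_insert hi]
        simp only [smul_eq_mul, Nat.cast_add, Nat.cast_one, smul_eq_C_mul, map_add, map_one]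
        ring
  simpa [esymm, Finset.powersetCard_one] using key Finset.univ j

lemma derivation_eq_sum_raise (D : Derivation k (MvPolynomial σ k) (MvPolynomial σ k))
    (hD : ∀ i, D (X i) = X i ^ 2) :
    (D : MvPolynomial σ k →ₗ[k] MvPolynomial σ k) = ∑ i : σ, raise (fun a => (a : k)) i := by
  have hDmk : D = mkDerivation k fun i => X i ^ 2 := derivation_ext fun i => by simp [hD]
  refine end_ext fun m => ?_
  rw [Derivation.coeFn_coe, hDmk, mkDerivation_monomial, one_smul, Finsupp.sum,
    Finset.sum_subset (Finset.subset_univ m.support) fun i _ hi => by simp_all,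
    LinearMap.sum_apply]
  refine Finset.sum_congr rfl fun i _ => ?_
  rw [raise_monomial, smul_eq_mul, X_pow_eq_monomial, monomial_mul, one_mul, mul_one]
  by_cases h0 : m i = 0
  · simp [h0]
  · congr 2
    ext j
    by_cases hj : i = j
    · subst hj; simp; omega
    · simp [hj]

lemma derivation_add_esymm_one_eq_sum_raise
    (D : Derivation k (MvPolynomial σ k) (MvPolynomial σ k)) (hD : ∀ i, D (X i) = X i ^ 2) :
    (D : MvPolynomial σ k →ₗ[k] MvPolynomial σ k) + LinearMap.mulLeft k (esymm σ k 1) =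
      ∑ i : σ, raise (fun a => (a : k) + 1) i := by
  rw [derivation_eq_sum_raise D hD]
  refine end_ext fun m => ?_
  simp only [LinearMap.add_apply, LinearMap.sum_apply, raise_monomial, LinearMap.mulLeft_apply,
    esymm_one, Finset.sum_mul, ← Finset.sum_add_distrib]
  refine Finset.sum_congr rfl fun i _ => ?_
  rw [X, monomial_mul, add_comm (Finsupp.single i 1), ← map_add]
  simp

variable (k) in
/-- The `j`-th elementary symmetric function as an element of the polynomial ring on the
generators `e_1, …, e_n`: it is `1` for `j = 0` and vanishes for `j > n`. -/
noncomputable def elem (n : ℕ) : ℕ → MvPolynomial (Fin n) k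
  | 0 => 1
  | j + 1 => if h : j < n then X ⟨j, h⟩ else 0

lemma elem_succ_of_lt {n j : ℕ} (h : j < n) : elem k n (j + 1) = X ⟨j, h⟩ := dif_pos h

lemma elem_succ_of_le {n j : ℕ} (h : n ≤ j) : elem k n (j + 1) = 0 := dif_neg h.not_gt

variable (k) in
/-- The differential `∂` in terms of the elementary symmetric functions. -/
noncomputable def elemDerivation (n : ℕ) :
    Derivation k (MvPolynomial (Fin n) k) (MvPolynomial (Fin n) k) :=
  mkDerivation k fun i => elem k n 1 * X i - ((i : k) + 2) • elem k n (i + 2)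

lemma elemDerivation_elem (n j : ℕ) :
    elemDerivation k n (elem k n j) =
      elem k n 1 * elem k n j - ((j : k) + 1) • elem k n (j + 1) := by
  rcases j with _ | j
  · simp [elem]
  · rcases lt_or_ge j n with h | h
    · rw [elem_succ_of_lt h, elemDerivation, mkDerivation_X]
      congr 2
      push_cast
      ring
    · rw [elem_succ_of_le h, elem_succ_of_le (h.trans j.le_succ)]
      simp

variable (k) in
/-- The evaluation of polynomials in `e_1, …, e_n` as symmetric polynomials in `n` variables. -/
noncomputable def evalElem (n : ℕ) : MvPolynomial (Fin n) k →ₐ[k] MvPolynomial (Fin n) k :=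
  aeval fun i => esymm (Fin n) k (i + 1)

lemma evalElem_eq (n : ℕ) (f : MvPolynomial (Fin n) k) :
    evalElem k n f = (esymmAlgHom (Fin n) k n f).val := (esymmAlgHom_apply _).symm

lemma evalElem_injective (n : ℕ) : Function.Injective (evalElem k n) := fun f g h =>
  (esymmAlgHom_fin_bijective k n).1 (Subtype.ext (by rwa [evalElem_eq, evalElem_eq] at h))

lemma isSymmetric_evalElem (n : ℕ) (f : MvPolynomial (Fin n) k) : (evalElem k n f).IsSymmetric := by
  rw [evalElem_eq]
  exact (esymmAlgHom (Fin n) k n f).2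

lemma exists_evalElem_eq {n : ℕ} {f : MvPolynomial (Fin n) k} (hf : f.IsSymmetric) :
    ∃ F, evalElem k n F = f := by
  obtain ⟨F, hF⟩ := (esymmAlgHom_fin_bijective k n).2 ⟨f, hf⟩
  exact ⟨F, by rw [evalElem_eq, hF]⟩

lemma evalElem_elem (n j : ℕ) : evalElem k n (elem k n j) = esymm (Fin n) k j := by
  rcases j with _ | j
  · simp [elem]
  · rcases lt_or_ge j n with h | h
    · simp [elem_succ_of_lt h, evalElem]
    · rw [elem_succ_of_le h, map_zero, esymm, Finset.powersetCard_eq_empty.mpr (by simpa using h),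
        Finset.sum_empty]

/-- Two derivations related along an algebra map on the generators are related everywhere. -/
lemma map_derivation_of_X {τ A : Type*} [CommRing A] [Algebra k A]
    (Δ : Derivation k (MvPolynomial τ k) (MvPolynomial τ k)) (D : Derivation k A A)
    (φ : MvPolynomial τ k →ₐ[k] A) (h : ∀ i, φ (Δ (X i)) = D (φ (X i))) (f : MvPolynomial τ k) :
    φ (Δ f) = D (φ f) := by
  induction f using MvPolynomial.induction_on with
  | C a => simp [← algebraMap_eq]
  | add f g hf hg => rw [map_add, map_add, map_add, map_add, hf, hg]
  | mul_X f i hf =>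
    rw [Δ.leibniz, map_mul, D.leibniz, ← h, ← hf]
    simp

lemma evalElem_elemDerivation {n : ℕ}
    (D : Derivation k (MvPolynomial (Fin n) k) (MvPolynomial (Fin n) k))
    (hD : ∀ i, D (X i) = X i ^ 2) (f : MvPolynomial (Fin n) k) :
    evalElem k n (elemDerivation k n f) = D (evalElem k n f) := by
  refine map_derivation_of_X _ _ _ (fun i => ?_) f
  have : X i = elem k n (i + 1) := (elem_succ_of_lt i.2).symm
  rw [this, elemDerivation_elem, evalElem_elem, derivation_esymm D hD, map_sub, map_mul, map_smul,
    evalElem_elem, evalElem_elem, evalElem_elem]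

variable (k) in
/-- The twisted differential `f ↦ ∂ f + a e_1 f` in terms of the elementary symmetric functions. -/
noncomputable def twisted (n : ℕ) (a : k) : Module.End k (MvPolynomial (Fin n) k) :=
  (elemDerivation k n : MvPolynomial (Fin n) k →ₗ[k] MvPolynomial (Fin n) k) +
    a • LinearMap.mulLeft k (elem k n 1)

lemma twisted_apply (n : ℕ) (a : k) (f : MvPolynomial (Fin n) k) :
    twisted k n a f = elemDerivation k n f + a • (elem k n 1 * f) := rfl

variable (k) in
/-- The derivation `x_i ↦ x_i ^ 2`. -/
noncomputable def sqDerivation (n : ℕ) :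
    Derivation k (MvPolynomial (Fin n) k) (MvPolynomial (Fin n) k) :=
  mkDerivation k fun i => X i ^ 2

lemma evalElem_twisted_zero_pow (n r : ℕ) (f : MvPolynomial (Fin n) k) :
    evalElem k n ((twisted k n 0 ^ r) f) =
      ((∑ i : Fin n, raise (fun a => (a : k)) i) ^ r) (evalElem k n f) := by
  induction r with
  | zero => simp
  | succ r ih =>
    rw [pow_succ', pow_succ', Module.End.mul_apply, Module.End.mul_apply, ← ih,
      ← derivation_eq_sum_raise (sqDerivation k n) (mkDerivation_X k _), twisted_apply, zero_smul,
      add_zero]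
    exact evalElem_elemDerivation _ (mkDerivation_X k _) _

lemma evalElem_twisted_one_pow (n r : ℕ) (f : MvPolynomial (Fin n) k) :
    evalElem k n ((twisted k n 1 ^ r) f) =
      ((∑ i : Fin n, raise (fun a => (a : k) + 1) i) ^ r) (evalElem k n f) := by
  induction r with
  | zero => simp
  | succ r ih =>
    rw [pow_succ', pow_succ', Module.End.mul_apply, Module.End.mul_apply, ← ih,
      ← derivation_add_esymm_one_eq_sum_raise (sqDerivation k n) (mkDerivation_X k _),
      twisted_apply, one_smul, map_add, evalElem_elemDerivation _ (mkDerivation_X k _), map_mul,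
      evalElem_elem]
    rfl

variable {p : ℕ}

lemma prod_natCast_add_eq_zero (hp : p.Prime) [CharP k p] (a : ℕ) :
    ∏ t ∈ Finset.range p, ((a + t : ℕ) : k) = 0 := by
  rw [← Nat.cast_prod, ← Nat.ascFactorial_eq_prod_range, CharP.cast_eq_zero_iff k p]
  exact (Nat.dvd_factorial hp.pos le_rfl).trans (Nat.factorial_dvd_ascFactorial a p)

lemma twisted_zero_pow_char (hp : p.Prime) [CharP k p] (n : ℕ) : twisted k n 0 ^ p = 0 := by
  refine LinearMap.ext fun f => evalElem_injective n ?_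
  rw [evalElem_twisted_zero_pow, sum_raise_pow_char hp fun a => ?_]
  · simp
  · exact prod_natCast_add_eq_zero hp a

lemma twisted_one_pow_char (hp : p.Prime) [CharP k p] (n : ℕ) : twisted k n 1 ^ p = 0 := by
  refine LinearMap.ext fun f => evalElem_injective n ?_
  rw [evalElem_twisted_one_pow, sum_raise_pow_char hp fun a => ?_]
  · simp
  · rw [← prod_natCast_add_eq_zero (k := k) hp (a + 1)]
    refine Finset.prod_congr rfl fun t _ => ?_
    push_cast
    ring

lemma exists_eq_twisted_one_pow (hp : p.Prime) [CharP k p] {n : ℕ} (hn : (n : k) ≠ 0)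
    {f : MvPolynomial (Fin n) k} (hf : twisted k n 1 f = 0) :
    ∃ h, f = (twisted k n 1 ^ (p - 1)) h := by
  obtain ⟨h, hsymm, hh⟩ := exists_symmetric_eq_sum_raise_succ_pow hp (by simpa using hn)
    (isSymmetric_evalElem n f) (by simpa [hf] using (evalElem_twisted_one_pow n 1 f).symm)
  obtain ⟨H, rfl⟩ := exists_evalElem_eq hsymm
  exact ⟨H, evalElem_injective n (by rw [evalElem_twisted_one_pow, ← hh])⟩

lemma exists_eq_C_add_twisted_zero_pow (hp : p.Prime) [CharP k p] {n : ℕ} (hn : n < p)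
    {f : MvPolynomial (Fin n) k} (hf : twisted k n 0 f = 0) :
    ∃ r h, f = C r + (twisted k n 0 ^ (p - 1)) h := by
  obtain ⟨r, h, hsymm, hh⟩ := exists_symmetric_eq_C_add_sum_raise_pow hp (by simpa using hn)
    (isSymmetric_evalElem n f) (by simpa [hf] using (evalElem_twisted_zero_pow n 1 f).symm)
  obtain ⟨H, rfl⟩ := exists_evalElem_eq hsymm
  refine ⟨r, H, evalElem_injective n ?_⟩
  rw [map_add, evalElem_twisted_zero_pow, hh]
  simp [evalElem]

/-- On `k[e_1, …, e_(p-1)]` every twist `a ≠ 0` is acyclic. -/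
lemma exists_eq_twisted_pow (hp : p.Prime) [CharP k p] {n : ℕ} (hn : n + 2 = p) {a : k}
    (ha : a ≠ 0) {f : MvPolynomial (Fin (n + 1)) k} (hf : twisted k (n + 1) a f = 0) :
    ∃ h, f = (twisted k (n + 1) a ^ (p - 1)) h := by
  let T : Derivation k (MvPolynomial (Fin (n + 1)) k) (MvPolynomial (Fin (n + 1)) k) :=
    mkDerivation k fun i => elem k (n + 1) i
  have hT {j : ℕ} (hj : j < n + 1) : T (elem k (n + 1) (j + 1)) = elem k (n + 1) j := by
    rw [elem_succ_of_lt hj, mkDerivation_X]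
  have hbr : ⁅T, elemDerivation k (n + 1)⁆ = 0 := by
    refine derivation_ext fun i => ?_
    have hX : X i = elem k (n + 1) (i + 1) := (elem_succ_of_lt i.2).symm
    rw [Derivation.commutator_apply, hX, hT i.2, elemDerivation_elem, elemDerivation_elem, map_sub,
      T.map_smul, T.leibniz, hT i.2, hT n.succ_pos]
    have hlast : ((i : k) + 2) • T (elem k (n + 1) (i + 2)) =
        ((i : k) + 2) • elem k (n + 1) (i + 1) := by
      rcases Nat.lt_or_ge (i + 1) (n + 1) with h | h
      · rw [hT h]
      · have hin : (i : ℕ) = n := by have := i.2; omega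
        have h0 : ((i : k) + 2) = 0 := by
          rw [hin]
          exact_mod_cast (CharP.cast_eq_zero_iff k p _).mpr hn.symm.dvd
        rw [h0, zero_smul, zero_smul]
    have hlast' : (((i + 1 : ℕ) : k) + 1) = (i : k) + 2 := by push_cast; ring
    rw [hlast', hlast]
    simp only [smul_eq_mul, elem, smul_eq_C_mul, map_add, map_one, map_ofNat,
      Derivation.zero_apply]
    ring
  refine ⟨_, eq_pow_apply_of_commutator_smul_one hp (neg_ne_zero.mpr ha)
    (T := (T : MvPolynomial (Fin (n + 1)) k →ₗ[k] MvPolynomial (Fin (n + 1)) k)) ?_ hf⟩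
  refine LinearMap.ext fun g => ?_
  have hg := congrArg (· g) hbr
  simp only [Derivation.commutator_apply, Derivation.zero_apply, sub_eq_zero] at hg
  simp only [Module.End.mul_apply, LinearMap.add_apply, Derivation.coeFn_coe, twisted_apply,
    map_add, Derivation.map_smul, T.leibniz, hg, hT n.succ_pos, LinearMap.smul_apply, Module.End.one_apply]
  simp only [elem, smul_eq_mul, mul_one]
  module

end Elementary

section Reduction

variable {k : Type*} [Field k] {n p : ℕ}

lemma twisted_zero_apply (n : ℕ) (f : MvPolynomial (Fin n) k) :
    twisted k n 0 f = elemDerivation k n f := by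
  rw [twisted_apply, zero_smul, add_zero]

lemma twisted_mul (n : ℕ) (a : k) (f g : MvPolynomial (Fin n) k) :
    twisted k n a (f * g) = twisted k n a f * g + f * elemDerivation k n g := by
  simp only [twisted_apply, Derivation.leibniz, smul_eq_mul, smul_eq_C_mul]
  ring

lemma twisted_add (n : ℕ) (a b : k) (f : MvPolynomial (Fin n) k) :
    twisted k n (a + b) f = twisted k n a f + b • (elem k n 1 * f) := by
  simp only [twisted_apply, add_smul]
  ring

variable (k n) in
/-- The inclusion `k[e_1, …, e_(n+1)] → k[e_1, …, e_(n+3)]`. -/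
noncomputable def elemIncl : MvPolynomial (Fin (n + 1)) k →ₐ[k] MvPolynomial (Fin (n + 3)) k :=
  aeval fun i => elem k (n + 3) (i + 1)

variable (k n) in
/-- The quotient map `k[e_1, …, e_(n+3)] → k[e_1, …, e_(n+1)][e_(n+2)]` sending `e_(n+3)` to `0`. -/
noncomputable def elemProj :
    MvPolynomial (Fin (n + 3)) k →ₐ[k] Polynomial (MvPolynomial (Fin (n + 1)) k) :=
  aeval fun i => if h : (i : ℕ) < n + 1 then Polynomial.C (X ⟨i, h⟩) else
    if (i : ℕ) = n + 1 then Polynomial.X else 0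

lemma elemProj_elem_of_le {j : ℕ} (hj : j ≤ n + 1) :
    elemProj k n (elem k (n + 3) j) = Polynomial.C (elem k (n + 1) j) := by
  rcases j with _ | j
  · simp [elem]
  · rw [elem_succ_of_lt (by omega : j < n + 3), elem_succ_of_lt (by omega : j < n + 1), elemProj,
      aeval_X, dif_pos (by simp; omega)]

lemma elemProj_elem_penultimate : elemProj k n (elem k (n + 3) (n + 2)) = Polynomial.X := by
  rw [elem_succ_of_lt (by omega : n + 1 < n + 3), elemProj, aeval_X]
  simp

lemma elemProj_elem_last : elemProj k n (elem k (n + 3) (n + 3)) = 0 := by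
  rw [elem_succ_of_lt (by omega : n + 2 < n + 3), elemProj, aeval_X]
  simp

lemma elemIncl_X (i : Fin (n + 1)) : elemIncl k n (X i) = elem k (n + 3) (i + 1) := aeval_X _ _

lemma elemProj_elemIncl (q : MvPolynomial (Fin (n + 1)) k) :
    elemProj k n (elemIncl k n q) = Polynomial.C q := by
  suffices h : (elemProj k n).comp (elemIncl k n) = Polynomial.CAlgHom from
    congrArg (· q) h
  refine algHom_ext fun i => ?_
  rw [AlgHom.comp_apply, elemIncl_X, elemProj_elem_of_le (by omega), elem_succ_of_lt i.2]
  rfl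

lemma fin_cases_elem (i : Fin (n + 3)) :
    (∃ i' : Fin (n + 1), X i = elem k (n + 3) (i' + 1)) ∨ X i = elem k (n + 3) (n + 2) ∨
      X i = elem k (n + 3) (n + 3) := by
  have hi : X i = elem k (n + 3) (i + 1) := (elem_succ_of_lt i.2).symm
  have := i.2
  rcases (by omega : (i : ℕ) < n + 1 ∨ (i : ℕ) = n + 1 ∨ (i : ℕ) = n + 2) with h | h | h
  · exact .inl ⟨⟨i, h⟩, hi⟩
  · exact .inr (.inl (by rw [hi, h]))
  · exact .inr (.inr (by rw [hi, h]))

lemma dvd_sub_eval₂_elemProj (f : MvPolynomial (Fin (n + 3)) k) :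
    elem k (n + 3) (n + 3) ∣ f - Polynomial.eval₂RingHom (elemIncl k n : _ →+* _)
      (elem k (n + 3) (n + 2)) (elemProj k n f) := by
  induction f using MvPolynomial.induction_on with
  | C a => simp [elemProj, elemIncl, ← algebraMap_eq]
  | add f g hf hg => simpa [add_sub_add_comm] using dvd_add hf hg
  | mul_X f i hf =>
    have hX : elem k (n + 3) (n + 3) ∣ X i - Polynomial.eval₂RingHom (elemIncl k n : _ →+* _)
        (elem k (n + 3) (n + 2)) (elemProj k n (X i)) := by
      rcases fin_cases_elem (k := k) i with ⟨i', h⟩ | h | h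
      · rw [h, elemProj_elem_of_le (by omega), elem_succ_of_lt i'.2]
        simp [elemIncl_X]
      · rw [h, elemProj_elem_penultimate]
        simp
      · rw [h, elemProj_elem_last]
        simp
    have hsplit (u v : MvPolynomial (Fin (n + 3)) k) :
        f * X i - u * v = (f - u) * X i + u * (X i - v) := by ring
    rw [map_mul, map_mul, hsplit]
    exact dvd_add (hf.mul_right _) (hX.mul_left _)

lemma elem_last_dvd_of_elemProj_eq_zero {f : MvPolynomial (Fin (n + 3)) k}
    (hf : elemProj k n f = 0) : elem k (n + 3) (n + 3) ∣ f := by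
  simpa [hf] using dvd_sub_eval₂_elemProj f

lemma elemDerivation_elem_last :
    elemDerivation k n (elem k n n) = elem k n 1 * elem k n n := by
  rw [elemDerivation_elem, elem_succ_of_le le_rfl, smul_zero, sub_zero]

lemma twisted_zero_pow_elem_last_mul (r : ℕ) (f : MvPolynomial (Fin n) k) :
    (twisted k n 0 ^ r) (elem k n n * f) = elem k n n * (twisted k n 1 ^ r) f := by
  induction r with
  | zero => simp
  | succ r ih =>
    rw [pow_succ', pow_succ', Module.End.mul_apply, Module.End.mul_apply, ih, twisted_mul,
      twisted_zero_apply, elemDerivation_elem_last, twisted_apply n 1, one_smul]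
    ring

lemma coeff_elemProj_twisted_zero [CharP k p] (hn : n + 2 = p)
    (f : MvPolynomial (Fin (n + 3)) k) (j : ℕ) :
    (elemProj k n (twisted k (n + 3) 0 f)).coeff j =
      twisted k (n + 1) j ((elemProj k n f).coeff j) := by
  have hp0 : (n : k) + 2 = 0 := by exact_mod_cast (CharP.cast_eq_zero_iff k p _).mpr hn.symm.dvd
  induction f using MvPolynomial.induction_on generalizing j with
  | C a =>
    rw [twisted_zero_apply, derivation_C, map_zero, Polynomial.coeff_zero, ← algebraMap_eq,
      AlgHom.commutes, IsScalarTower.algebraMap_apply k (MvPolynomial (Fin (n + 1)) k),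
      Polynomial.algebraMap_apply, Algebra.algebraMap_self_apply, Polynomial.coeff_C]
    split_ifs with hj
    · rw [hj, Nat.cast_zero, twisted_zero_apply, Derivation.map_algebraMap]
    · rw [map_zero]
  | add f g hf hg => simp [hf, hg]
  | mul_X f i hf =>
    rw [twisted_mul, map_add, map_mul, map_mul, map_mul, Polynomial.coeff_add]
    rcases fin_cases_elem (k := k) i with ⟨i', h⟩ | h | h
    · have hi' : elemProj k n (elemDerivation k (n + 3) (elem k (n + 3) (i' + 1))) =
          Polynomial.C (elemDerivation k (n + 1) (elem k (n + 1) (i' + 1))) := by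
        rw [elemDerivation_elem, elemDerivation_elem, map_sub, map_mul, map_smul,
          elemProj_elem_of_le (by omega), elemProj_elem_of_le (by omega)]
        rcases (by omega : (i' : ℕ) < n ∨ (i' : ℕ) = n) with hlt | heq
        · rw [elemProj_elem_of_le (by omega), map_sub, map_mul, Polynomial.smul_C]
        · have : ((i' + 1 : ℕ) : k) + 1 = 0 := by rw [heq, ← hp0]; push_cast; ring
          rw [this, zero_smul, zero_smul, sub_zero, sub_zero, map_mul]
      rw [h, hi', elemProj_elem_of_le (by omega), Polynomial.coeff_mul_C, Polynomial.coeff_mul_C,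
        Polynomial.coeff_mul_C, twisted_mul, hf]
    · have ha : elemProj k n (elemDerivation k (n + 3) (elem k (n + 3) (n + 2))) =
          Polynomial.C (elem k (n + 1) 1) * Polynomial.X := by
        rw [elemDerivation_elem, map_sub, map_mul, map_smul, elemProj_elem_of_le (by omega),
          elemProj_elem_penultimate, elemProj_elem_last, smul_zero, sub_zero]
      rw [h, ha, elemProj_elem_penultimate, ← mul_assoc]
      rcases j with _ | j
      · simp
      · rw [Polynomial.coeff_mul_X, Polynomial.coeff_mul_X, Polynomial.coeff_mul_X,
          Polynomial.coeff_mul_C, hf, Nat.cast_add, Nat.cast_one, twisted_add, one_smul, mul_comm]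
    · rw [h, elemDerivation_elem_last, map_mul, elemProj_elem_last]
      simp

lemma coeff_elemProj_twisted_zero_pow [CharP k p] (hn : n + 2 = p)
    (f : MvPolynomial (Fin (n + 3)) k) (j r : ℕ) :
    (elemProj k n ((twisted k (n + 3) 0 ^ r) f)).coeff j =
      (twisted k (n + 1) j ^ r) ((elemProj k n f).coeff j) := by
  induction r with
  | zero => simp
  | succ r ih =>
    rw [pow_succ', pow_succ', Module.End.mul_apply, Module.End.mul_apply,
      coeff_elemProj_twisted_zero hn, ih]

lemma twisted_zero_eq_zero_of_mem_adjoin [CharP k p] {x g : MvPolynomial (Fin n) k}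
    (hg : g ∈ Algebra.adjoin k {x ^ p}) : twisted k n 0 g = 0 := by
  rw [twisted_zero_apply]
  induction hg using Algebra.adjoin_induction with
  | mem y hy =>
    rw [Set.mem_singleton_iff.mp hy, Derivation.leibniz_pow, ← Nat.cast_smul_eq_nsmul k,
      CharP.cast_eq_zero, zero_smul]
  | algebraMap r => simp
  | add x y _ _ hx hy => rw [map_add, hx, hy, add_zero]
  | mul x y _ _ hx hy => simp [hx, hy]

/-- Cocycles in `k[e_1, …, e_(p+1)]` are polynomials in `e_p ^ p` up to `(p-1)`-fold
boundaries. -/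
lemma exists_mem_adjoin_add_twisted_zero_pow (hp : p.Prime) [CharP k p] (hn : n + 2 = p)
    {f : MvPolynomial (Fin (n + 3)) k} (hf : twisted k (n + 3) 0 f = 0) :
    ∃ g ∈ Algebra.adjoin k {elem k (n + 3) (n + 2) ^ p}, ∃ h,
      f = g + (twisted k (n + 3) 0 ^ (p - 1)) h := by
  set a := elem k (n + 3) (n + 2) with ha
  set P := elemProj k n f with hP
  have hcoeff (j : ℕ) : ∃ (r : k) (h : MvPolynomial (Fin (n + 1)) k),
      P.coeff j = C r + (twisted k (n + 1) j ^ (p - 1)) h ∧ (¬ p ∣ j → r = 0) := by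
    have hj : twisted k (n + 1) j (P.coeff j) = 0 := by
      rw [← coeff_elemProj_twisted_zero hn, hf, map_zero, Polynomial.coeff_zero]
    by_cases hpj : p ∣ j
    · rw [(CharP.cast_eq_zero_iff k p j).mpr hpj] at hj ⊢
      obtain ⟨r, h, hrh⟩ := exists_eq_C_add_twisted_zero_pow hp (by omega) hj
      exact ⟨r, h, hrh, fun h => absurd hpj h⟩
    · obtain ⟨h, hh⟩ := exists_eq_twisted_pow hp hn
        (fun h => hpj ((CharP.cast_eq_zero_iff k p j).mp h)) hj
      exact ⟨0, h, by rw [map_zero, zero_add, ← hh], fun _ => rfl⟩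
  choose r h hrh hr using hcoeff
  set g := ∑ j ∈ P.support, r j • a ^ j with hgdef
  set H := ∑ j ∈ P.support, elemIncl k n (h j) * a ^ j with hHdef
  have hg : g ∈ Algebra.adjoin k {a ^ p} := by
    refine Subalgebra.sum_mem _ fun j _ => ?_
    by_cases hpj : p ∣ j
    · obtain ⟨i, rfl⟩ := hpj
      rw [pow_mul]
      exact Subalgebra.smul_mem _ (Subalgebra.pow_mem _ (Algebra.self_mem_adjoin_singleton k _) i) _
    · rw [hr j hpj, zero_smul]
      exact Subalgebra.zero_mem _
  have hzero : elemProj k n (f - g - (twisted k (n + 3) 0 ^ (p - 1)) H) = 0 := by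
    have hπg (j : ℕ) : (elemProj k n g).coeff j = if j ∈ P.support then C (r j) else 0 := by
      simp only [hgdef, map_sum, map_smul, map_pow, ha, elemProj_elem_penultimate,
        Polynomial.finsetSum_coeff, Polynomial.coeff_smul, Polynomial.coeff_X_pow, smul_ite,
        smul_zero, Finset.sum_ite_eq]
      split_ifs <;> simp [smul_eq_C_mul]
    have hπH (j : ℕ) : (elemProj k n H).coeff j = if j ∈ P.support then h j else 0 := by
      simp only [hHdef, map_sum, map_mul, map_pow, ha, elemProj_elem_penultimate,
        elemProj_elemIncl, Polynomial.finsetSum_coeff, Polynomial.coeff_C_mul,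
        Polynomial.coeff_X_pow, mul_ite, mul_zero, Finset.sum_ite_eq, mul_one]
    ext1 j
    rw [map_sub, map_sub, Polynomial.coeff_sub, Polynomial.coeff_sub,
      coeff_elemProj_twisted_zero_pow hn, hπg, hπH, Polynomial.coeff_zero, ← hP]
    split_ifs with hj
    · rw [hrh j]
      simp
    · rw [Polynomial.notMem_support_iff.mp hj]
      simp
  obtain ⟨q, hq⟩ := elem_last_dvd_of_elemProj_eq_zero hzero
  have hq0 : twisted k (n + 3) 1 q = 0 := by
    have hmul := twisted_zero_pow_elem_last_mul 1 q
    rw [← hq, pow_one, pow_one, map_sub, map_sub, hf, twisted_zero_eq_zero_of_mem_adjoin hg,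
      ← Module.End.mul_apply, ← pow_succ', Nat.sub_add_cancel hp.one_le, twisted_zero_pow_char hp,
      LinearMap.zero_apply, sub_zero, sub_zero] at hmul
    refine (mul_eq_zero.mp hmul.symm).resolve_left ?_
    rw [elem_succ_of_lt (by omega : n + 2 < n + 3)]
    exact X_ne_zero _
  have hn3 : ((n + 3 : ℕ) : k) ≠ 0 := by
    have hp0 : ((n + 2 : ℕ) : k) = 0 := (CharP.cast_eq_zero_iff k p _).mpr hn.symm.dvd
    rw [Nat.cast_succ, hp0, zero_add]
    exact one_ne_zero
  obtain ⟨s, hs⟩ := exists_eq_twisted_one_pow hp hn3 hq0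
  refine ⟨g, hg, H + elem k (n + 3) (n + 3) * s, ?_⟩
  rw [map_add, twisted_zero_pow_elem_last_mul, ← hs, ← hq]
  ring

/-- Modulo `e_j` for `j ≠ p`, boundaries vanish while polynomials in `e_p ^ p` do not. -/
lemma eq_zero_of_mem_adjoin_of_eq_twisted_zero (hp : p.Prime) [CharP k p] (hn : n + 2 = p)
    {g h : MvPolynomial (Fin (n + 3)) k}
    (hg : g ∈ Algebra.adjoin k {elem k (n + 3) (n + 2) ^ p}) (hgh : twisted k (n + 3) 0 h = g) :
    g = 0 := by
  have hp0 : (n : k) + 2 = 0 := by exact_mod_cast (CharP.cast_eq_zero_iff k p _).mpr hn.symm.dvd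
  let ψ : MvPolynomial (Fin (n + 3)) k →ₐ[k] Polynomial k :=
    aeval fun i => if (i : ℕ) = n + 1 then Polynomial.X else 0
  have hψ {j : ℕ} (hj : j ≠ 0) : ψ (elem k (n + 3) j) = if j = n + 2 then Polynomial.X else 0 := by
    obtain ⟨j, rfl⟩ := Nat.exists_eq_succ_of_ne_zero hj
    rcases lt_or_ge j (n + 3) with h | h
    · rw [elem_succ_of_lt h, aeval_X]
      simp
    · rw [elem_succ_of_le h, map_zero, if_neg (by omega)]
  have hψD (f : MvPolynomial (Fin (n + 3)) k) : ψ (elemDerivation k (n + 3) f) = 0 := by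
    refine map_derivation_of_X _ (0 : Derivation k (Polynomial k) (Polynomial k)) ψ (fun i => ?_) f
    have hX : X i = elem k (n + 3) (i + 1) := (elem_succ_of_lt i.2).symm
    rw [hX, elemDerivation_elem, map_sub, map_mul, map_smul, hψ one_ne_zero, if_neg (by omega),
      hψ (j := i + 1 + 1) (by omega), Derivation.zero_apply, zero_mul, zero_sub, neg_eq_zero]
    split_ifs with h
    · rw [show ((i + 1 : ℕ) : k) + 1 = ((i + 1 + 1 : ℕ) : k) by push_cast; ring, h]
      push_cast
      rw [hp0, zero_smul]
    · rw [smul_zero]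
  rw [Algebra.adjoin_singleton_eq_range_aeval] at hg
  obtain ⟨Q, rfl⟩ := hg
  have hQ : Polynomial.expand k p Q = 0 := by
    have := hψD h
    rw [← twisted_zero_apply, hgh] at this
    have hcomp : ψ.comp (Polynomial.aeval (elem k (n + 3) (n + 2) ^ p)) = Polynomial.expand k p :=
      Polynomial.algHom_ext (by simp [hψ])
    rw [← hcomp]
    exact this
  rw [(Polynomial.expand_eq_zero hp.pos).mp hQ]
  simp

end Reduction

/-- In `p+1` variables: (i) the inclusion of `B = k[e_p^p]` (with zero differential) into
`Sym_{p+1}` is a quasi-isomorphism of `p`-complexes; (ii) the rank-one twisted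
`p`-complex `(Sym_{p+1}, D_1)` with `D_1(f) = ∂(f) + e_1·f` is acyclic. -/
theorem stmt9 (p : ℕ) (hp : p.Prime) (k : Type*) [Field k] [CharP k p]
    (D : Derivation k (MvPolynomial (Fin (p + 1)) k) (MvPolynomial (Fin (p + 1)) k))
    (hD : ∀ i, D (X i) = X i ^ 2)
    (B : Subalgebra k (MvPolynomial (Fin (p + 1)) k))
    (hB : B = Algebra.adjoin k {esymm (Fin (p + 1)) k p ^ p})
    (D1 : MvPolynomial (Fin (p + 1)) k → MvPolynomial (Fin (p + 1)) k)
    (hD1 : ∀ f, D1 f = D f + esymm (Fin (p + 1)) k 1 * f) :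
    (∀ s : ℕ, 1 ≤ s → s ≤ p - 1 →
      (∀ f : MvPolynomial (Fin (p + 1)) k, f.IsSymmetric → (⇑D)^[s] f = 0 →
        ∃ g ∈ B, ∃ h : MvPolynomial (Fin (p + 1)) k, h.IsSymmetric ∧ f = g + (⇑D)^[p - s] h) ∧
      (∀ g ∈ B, (∃ h : MvPolynomial (Fin (p + 1)) k, h.IsSymmetric ∧ (⇑D)^[p - s] h = g) →
        g = 0)) ∧
    (∀ s : ℕ, 1 ≤ s → s ≤ p - 1 →
      {f | f.IsSymmetric ∧ D1^[s] f = 0} = D1^[p - s] '' {f | f.IsSymmetric}) := by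
  obtain ⟨n, rfl⟩ : ∃ n, p = n + 2 := ⟨p - 2, by have := hp.two_le; omega⟩
  set Φ := evalElem k (n + 3) with hΦ
  have hΦinj : Function.Injective Φ := evalElem_injective _
  have hDpow (r : ℕ) (F : MvPolynomial (Fin (n + 3)) k) :
      (⇑D)^[r] (Φ F) = Φ ((twisted k (n + 3) 0 ^ r) F) := by
    rw [Module.End.pow_apply]
    refine (Function.Semiconj.iterate_right (f := Φ) (fun F => ?_) r F).symm
    rw [twisted_zero_apply, hΦ, evalElem_elemDerivation D hD]
  have hD1pow (r : ℕ) (F : MvPolynomial (Fin (n + 3)) k) :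
      D1^[r] (Φ F) = Φ ((twisted k (n + 3) 1 ^ r) F) := by
    rw [Module.End.pow_apply]
    refine (Function.Semiconj.iterate_right (f := Φ) (fun F => ?_) r F).symm
    rw [twisted_apply, one_smul, map_add, map_mul, hΦ, evalElem_elemDerivation D hD, evalElem_elem,
      hD1]
  have hBmap : B = (Algebra.adjoin k {elem k (n + 3) (n + 2) ^ (n + 2)}).map Φ := by
    rw [hB, AlgHom.map_adjoin_singleton, map_pow, hΦ, evalElem_elem]
  have hn3 : ((n + 3 : ℕ) : k) ≠ 0 := by
    rw [Nat.cast_succ, CharP.cast_eq_zero k (n + 2), zero_add]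
    exact one_ne_zero
  refine ⟨fun s hs hsp => ⟨fun f hf hDf => ?_, ?_⟩, fun s hs hsp => ?_⟩
  · obtain ⟨F, rfl⟩ := exists_evalElem_eq hf
    rw [hDpow, map_eq_zero_iff Φ hΦinj] at hDf
    obtain ⟨g, hg, h, hgh⟩ := exists_eq_add_pow_apply
      (B := (Algebra.adjoin k {elem k (n + 3) (n + 2) ^ (n + 2)} : Set _))
      (fun _ h => exists_mem_adjoin_add_twisted_zero_pow hp rfl h)
      (fun _ hg _ h => eq_zero_of_mem_adjoin_of_eq_twisted_zero hp rfl hg h) s hs hsp F hDf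
    refine ⟨Φ g, hBmap ▸ ⟨g, hg, rfl⟩, Φ h, isSymmetric_evalElem _ h, ?_⟩
    rw [hDpow, ← map_add, ← hgh]
  · rintro g hg ⟨h, hh, hhg⟩
    obtain ⟨H, rfl⟩ := exists_evalElem_eq hh
    rw [hBmap] at hg
    obtain ⟨G, hG, rfl⟩ := hg
    have hHG := hΦinj ((hDpow _ H).symm.trans hhg)
    rw [show n + 2 - s = (n + 1 - s) + 1 by omega, pow_succ', Module.End.mul_apply] at hHG
    exact (congrArg Φ (eq_zero_of_mem_adjoin_of_eq_twisted_zero hp rfl hG hHG)).trans (map_zero Φ)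
  · ext f
    constructor
    · rintro ⟨hf, hDf⟩
      obtain ⟨F, rfl⟩ := exists_evalElem_eq hf
      rw [hD1pow, map_eq_zero_iff Φ hΦinj] at hDf
      obtain ⟨g, rfl, h, hgh⟩ := exists_eq_add_pow_apply (B := {0}) (p := n + 2)
        (fun f hf => ⟨0, rfl, by simpa using exists_eq_twisted_one_pow hp hn3 hf⟩)
        (fun _ hg _ _ => hg) s hs hsp F hDf
      exact ⟨Φ h, isSymmetric_evalElem _ h, by rw [hD1pow, hgh, zero_add]⟩
    · rintro ⟨h, hh, rfl⟩
      obtain ⟨H, rfl⟩ := exists_evalElem_eq hh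
      refine ⟨by rw [hD1pow]; exact isSymmetric_evalElem _ _, ?_⟩
      rw [← Function.iterate_add_apply, show s + (n + 2 - s) = n + 2 by omega, hD1pow,
        twisted_one_pow_char hp, LinearMap.zero_apply, map_zero]
end

section
/- Let k be a field of characteristic p (p prime), c ∈ ℕ, and n ∈ ℕ with cp ≤ n ≤ (c+1)p − 1 and n ≥ 1. Let B_c ⊂ Sym_n be the k-subalgebra generated by {e_{jp}^p : 1 ≤ j ≤ c} (so B_0 = k; note ∂ vanishes on B_c in characteristic p). Then the inclusion B_c ↪ Sym_n is a quasi-isomorphism of p-complexes: for every s with 1 ≤ s ≤ p−1, every f ∈ Sym_n with ∂^s f = 0 can be written f = g + ∂^{p−s}(h) with g ∈ B_c and h ∈ Sym_n, and the only element of B_c lying in ∂^{p−s}(Sym_n) is 0. -/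
open MvPolynomial

namespace SymmPComplex

section WeylRelation

variable {k V : Type*} [Field k] [AddCommGroup V] [Module k V]

/-- If `∂` and `θ` preserve a subspace `M` on which `∂θ - θ∂ = 1`, then in characteristic `p` the
kernel of `∂ ^ s` on `M` is contained in `∂ ^ (p - s) M` for every `s < p`. -/
theorem exists_eq_pow_apply_of_weyl {p : ℕ} (hp : p.Prime) [CharP k p] (d t : Module.End k V)
    (M : Submodule k V) (hd : ∀ x ∈ M, d x ∈ M) (ht : ∀ x ∈ M, t x ∈ M)
    (hdt : ∀ x ∈ M, d (t x) = t (d x) + x) {s : ℕ} (hs : s < p) {f : V} (hf : f ∈ M)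
    (hsf : (d ^ s) f = 0) : ∃ h ∈ M, f = (d ^ (p - s)) h := by
  have hdpow (m : ℕ) : ∀ x ∈ M, (d ^ m) x ∈ M := by
    induction m with
    | zero => simp
    | succ m ih => intro x hx; rw [pow_succ', Module.End.mul_apply]; exact hd _ (ih x hx)
  have htpow (m : ℕ) : ∀ x ∈ M, (t ^ m) x ∈ M := by
    induction m with
    | zero => simp
    | succ m ih => intro x hx; rw [pow_succ', Module.End.mul_apply]; exact ht _ (ih x hx)
  have hdmt (m : ℕ) : ∀ x ∈ M, (d ^ m) (t (d x)) = t (d ((d ^ m) x)) + (m : k) • (d ^ m) x := by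
    induction m with
    | zero => simp
    | succ m ih =>
      intro x hx
      rw [pow_succ', Module.End.mul_apply, ih x hx, map_add, hdt _ (hd _ (hdpow m x hx)),
        map_smul, Module.End.mul_apply]
      push_cast
      module
  have hdtm (m : ℕ) : ∀ x ∈ M, d (t ((t ^ m) x)) =
      (t ^ m) (t (d x)) + ((m : k) + 1) • (t ^ m) x := by
    induction m with
    | zero => intro x hx; simp [hdt x hx]
    | succ m ih =>
      intro x hx
      rw [pow_succ', Module.End.mul_apply, hdt _ (ht _ (htpow m x hx)), ih x hx, map_add,
        map_smul, Module.End.mul_apply]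
      push_cast
      module
  have hdmtm (m : ℕ) : ∀ x ∈ M, (d ^ (m + 1)) ((t ^ (m + 1)) x) =
      (d ^ m) ((t ^ m) (t (d x) + ((m : k) + 1) • x)) := by
    intro x hx
    rw [pow_succ d, Module.End.mul_apply, pow_succ' t, Module.End.mul_apply, hdtm m x hx,
      map_add (t ^ m), map_smul (t ^ m)]
  induction s generalizing f with
  | zero => exact ⟨0, M.zero_mem, by simpa using hsf⟩
  | succ s ih =>
    obtain ⟨m, rfl⟩ : ∃ m, p = s + 1 + m := ⟨p - (s + 1), by omega⟩
    let I : Submodule k V := M.map (d ^ m)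
    have hIN : ∀ x ∈ I, x ∈ M ∧ t (d x) ∈ I := by
      rintro _ ⟨x, hx, rfl⟩
      refine ⟨hdpow m x hx, ?_⟩
      have : t (d ((d ^ m) x)) = (d ^ m) (t (d x)) - (m : k) • (d ^ m) x := by
        rw [hdmt m x hx]; abel
      rw [this]
      exact I.sub_mem ⟨_, ht _ (hd _ hx), rfl⟩ (I.smul_mem _ ⟨_, hx, rfl⟩)
    have hIdt (i : ℕ) : ∀ x ∈ I, (d ^ i) ((t ^ i) x) ∈ I := by
      induction i with
      | zero => simp
      | succ i ih' =>
        intro x hx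
        rw [hdmtm i x (hIN x hx).1]
        exact ih' _ (I.add_mem (hIN x hx).2 (I.smul_mem _ hx))
    have hu : t (d f) - (s : k) • f ∈ I := by
      obtain ⟨h, hh, e⟩ := ih (by omega) (f := t (d f) - (s : k) • f)
        (M.sub_mem (ht _ (hd _ hf)) (M.smul_mem _ hf)) (by
          rw [map_sub, hdmt s f hf, map_smul, ← Module.End.mul_apply d, ← pow_succ', hsf]
          simp)
      refine ⟨d h, hd _ hh, ?_⟩
      rw [e, ← Module.End.mul_apply, ← pow_succ]
      congr 2
      omega
    have key (i : ℕ) (hi : s + i < s + 1 + m) :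
        ∃ c : k, c ≠ 0 ∧ (d ^ i) ((t ^ i) f) - c • f ∈ I := by
      induction i with
      | zero => exact ⟨1, one_ne_zero, by simp⟩
      | succ i ih' =>
        obtain ⟨c, hc, hci⟩ := ih' (by omega)
        have hc' : ((s + i + 1 : ℕ) : k) ≠ 0 := by
          rw [Ne, CharP.cast_eq_zero_iff k (s + 1 + m)]
          exact Nat.not_dvd_of_pos_of_lt (by omega) (by omega)
        refine ⟨((s + i + 1 : ℕ) : k) * c, mul_ne_zero hc' hc, ?_⟩
        have : t (d f) + ((i : k) + 1) • f
            = (t (d f) - (s : k) • f) + ((s + i + 1 : ℕ) : k) • f := by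
          push_cast; module
        rw [hdmtm i f hf, this, map_add, map_add, map_smul, map_smul, mul_smul, add_sub_assoc,
          ← smul_sub]
        exact I.add_mem (hIdt i _ hu) (I.smul_mem _ hci)
    obtain ⟨c, hc, hci⟩ := key m (by omega)
    have : c • f ∈ I := by
      have h1 : (d ^ m) ((t ^ m) f) ∈ I := ⟨_, htpow m f hf, rfl⟩
      simpa using I.sub_mem h1 hci
    obtain ⟨h, hh, e⟩ := (I.smul_mem_iff hc).1 this
    exact ⟨h, hh, by rw [← e, Nat.add_sub_cancel_left]⟩

end WeylRelation

section Derivation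

theorem iterate_derivation_mul {k A : Type*} [CommRing k] [CommRing A] [Algebra k A]
    (D : Derivation k A A) (m : ℕ) (a b : A) :
    D^[m] (a * b) =
      ∑ ij ∈ Finset.HasAntidiagonal.antidiagonal m, m.choose ij.1 • (D^[ij.1] a * D^[ij.2] b) := by
  induction m with
  | zero => simp
  | succ m ih =>
    rw [Finset.sum_antidiagonal_choose_succ_nsmul (M := A) (fun i j => D^[i] a * D^[j] b) m]
    simp only [Function.iterate_succ_apply', ih, map_sum, map_nsmul, Derivation.leibniz, smul_add,
      Finset.sum_add_distrib, smul_eq_mul]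
    congr 1
    refine Finset.sum_congr rfl fun ij hij => ?_
    rw [m.choose_symm_of_eq_add (Finset.HasAntidiagonal.mem_antidiagonal.1 hij).symm, mul_comm]

theorem iterate_char_derivation_mul {k A : Type*} [CommRing k] [CommRing A] [Algebra k A]
    {p : ℕ} (hp : p.Prime) [CharP A p] (D : Derivation k A A) (a b : A) :
    D^[p] (a * b) = D^[p] a * b + a * D^[p] b := by
  rw [iterate_derivation_mul, Finset.Nat.sum_antidiagonal_eq_sum_range_succ_mk,
    Finset.sum_range_succ, ← Nat.succ_pred_eq_of_pos hp.pos, Finset.sum_range_succ',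
    Finset.sum_eq_zero]
  · simp [add_comm]
  · intro i hi
    have : ((p.choose (i + 1) : ℕ) : A) = 0 := by
      rw [CharP.cast_eq_zero_iff A p]
      refine hp.dvd_choose_self (by omega) ?_
      have := Finset.mem_range.1 hi
      rw [Nat.pred_eq_sub_one] at this
      omega
    rw [Nat.succ_pred_eq_of_pos hp.pos]
    simp [nsmul_eq_mul, this]

theorem map_prod_eq_sum_mul_prod {k A ι : Type*} [CommRing k] [CommRing A] [Algebra k A]
    (D : Derivation k A A) (s : Finset ι) (f g : ι → A) (h : ∀ i ∈ s, D (f i) = g i * f i) :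
    D (∏ i ∈ s, f i) = (∑ i ∈ s, g i) * ∏ i ∈ s, f i := by
  classical
  induction s using Finset.induction_on with
  | empty => simp
  | insert a s ha ih =>
    rw [Finset.prod_insert ha, Finset.sum_insert ha, Derivation.leibniz,
      ih fun i hi => h i (Finset.mem_insert_of_mem hi), h a (Finset.mem_insert_self a s),
      smul_eq_mul, smul_eq_mul]
    ring

theorem multiset_esymm_zero {A : Type*} [CommRing A] (s : Multiset A) : s.esymm 0 = 1 := by
  simp [Multiset.esymm]

theorem multiset_esymm_cons_succ {A : Type*} [CommRing A] (a : A) (s : Multiset A) (j : ℕ) :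
    (a ::ₘ s).esymm (j + 1) = s.esymm (j + 1) + a * s.esymm j := by
  simp [Multiset.esymm, Multiset.powersetCard_cons, Multiset.map_map, Multiset.sum_map_mul_left]

theorem multiset_esymm_empty_succ {A : Type*} [CommRing A] (j : ℕ) :
    (0 : Multiset A).esymm (j + 1) = 0 := by
  rw [Multiset.esymm, Multiset.powersetCard_eq_empty _ (by simp)]
  simp

theorem map_multiset_esymm {k A : Type*} [CommRing k] [CommRing A] [Algebra k A]
    (D : Derivation k A A) (s : Multiset A) (h : ∀ x ∈ s, D x = x ^ 2) (j : ℕ) :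
    D (s.esymm j) = s.sum * s.esymm j - (j + 1) * s.esymm (j + 1) := by
  induction s using Multiset.induction_on generalizing j with
  | empty => cases j <;> simp [multiset_esymm_zero, multiset_esymm_empty_succ]
  | cons a s ih =>
    have ih := ih fun x hx => h x (Multiset.mem_cons_of_mem hx)
    have ha := h a (Multiset.mem_cons_self a s)
    cases j with
    | zero =>
      have := ih 0
      simp only [multiset_esymm_zero, Multiset.sum_cons, multiset_esymm_cons_succ] at this ⊢
      linear_combination this
    | succ j =>
      rw [multiset_esymm_cons_succ, multiset_esymm_cons_succ, map_add, Derivation.leibniz, ih, ih,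
        ha, Multiset.sum_cons]
      simp only [smul_eq_mul]
      push_cast
      ring

end Derivation

section Twist

variable {k : Type*} [Field k] {n : ℕ}

/-- The derivation `∂` of `k[x_0, …, x_{n-1}]` with `∂ x_i = x_i ^ 2`. -/
noncomputable def sqDeriv (k : Type*) [Field k] (n : ℕ) :
    Derivation k (MvPolynomial (Fin n) k) (MvPolynomial (Fin n) k) :=
  mkDerivation k fun i => X i ^ 2

theorem sqDeriv_X (i : Fin n) : sqDeriv k n (X i) = X i ^ 2 := mkDerivation_X _ _ _

/-- The operator `f ↦ ∂ f + a e_1 f`. -/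
noncomputable def twist (n : ℕ) (a : k) : Module.End k (MvPolynomial (Fin n) k) :=
  (sqDeriv k n).toLinearMap + a • LinearMap.mulLeft k (∑ i, X i)

theorem twist_apply (a : k) (f : MvPolynomial (Fin n) k) :
    twist n a f = sqDeriv k n f + C a * (∑ i, X i) * f := by
  simp [twist, smul_eq_C_mul, mul_assoc]

theorem twist_zero_apply (f : MvPolynomial (Fin n) k) : twist n 0 f = sqDeriv k n f := by
  simp [twist_apply]

theorem twist_zero_pow_apply (s : ℕ) (f : MvPolynomial (Fin n) k) :
    (twist n 0 ^ s) f = (sqDeriv k n)^[s] f := by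
  rw [Module.End.pow_apply, funext twist_zero_apply]

theorem twist_pow_mul {w : MvPolynomial (Fin n) k} {b : k}
    (hw : sqDeriv k n w = C b * (∑ i, X i) * w) (a : k) (s : ℕ) (f : MvPolynomial (Fin n) k) :
    (twist n a ^ s) (w * f) = w * (twist n (a + b) ^ s) f := by
  induction s with
  | zero => simp
  | succ s ih =>
    rw [pow_succ', Module.End.mul_apply, ih, pow_succ', Module.End.mul_apply, twist_apply,
      twist_apply, Derivation.leibniz, hw, C_add, smul_eq_mul, smul_eq_mul]
    ring

theorem sqDeriv_prod_X_pow (m : ℕ) :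
    sqDeriv k n ((∏ i, X i) ^ m) = C (m : k) * (∑ i, X i) * (∏ i, X i) ^ m := by
  have h : sqDeriv k n (∏ i, X i) = (∑ i, X i) * ∏ i, X i :=
    map_prod_eq_sum_mul_prod _ _ _ _ fun i _ => by rw [sqDeriv_X, sq]
  rcases m with _ | m
  · simp
  · rw [Derivation.leibniz_pow, h, Nat.add_sub_cancel, C_eq_coe_nat, nsmul_eq_mul, smul_eq_mul]
    ring

theorem twist_pow_prod_X_mul (m : ℕ) (a : k) (s : ℕ) (f : MvPolynomial (Fin n) k) :
    (twist n a ^ s) ((∏ i, X i) ^ m * f) = (∏ i, X i) ^ m * (twist n (a + m) ^ s) f :=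
  twist_pow_mul (sqDeriv_prod_X_pow m) a s f

theorem prod_X_ne_zero : (∏ i, X i : MvPolynomial (Fin n) k) ≠ 0 :=
  Finset.prod_ne_zero_iff.2 fun i _ => X_ne_zero i

theorem iterate_sqDeriv_X (m : ℕ) (i : Fin n) :
    (sqDeriv k n)^[m] (X i) = (m.factorial : MvPolynomial (Fin n) k) * X i ^ (m + 1) := by
  induction m with
  | zero => simp
  | succ m ih =>
    rw [Function.iterate_succ_apply', ih, Derivation.leibniz, Derivation.leibniz_pow, sqDeriv_X,
      Derivation.map_natCast, Nat.factorial_succ]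
    simp only [smul_eq_mul, nsmul_eq_mul, Nat.add_sub_cancel]
    push_cast
    ring

theorem iterate_char_sqDeriv {p : ℕ} (hp : p.Prime) [CharP k p] (f : MvPolynomial (Fin n) k) :
    (sqDeriv k n)^[p] f = 0 := by
  induction f using MvPolynomial.induction_on with
  | C a =>
    obtain ⟨m, rfl⟩ := Nat.exists_eq_succ_of_ne_zero hp.ne_zero
    rw [Function.iterate_succ_apply, ← algebraMap_eq, Derivation.map_algebraMap,
      iterate_map_zero]
  | add f g hf hg => rw [iterate_map_add, hf, hg, add_zero]
  | mul_X f i hf =>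
    have : ((p.factorial : ℕ) : MvPolynomial (Fin n) k) = 0 :=
      (CharP.cast_eq_zero_iff _ p _).2 (hp.dvd_factorial.2 le_rfl)
    rw [iterate_char_derivation_mul hp, hf, iterate_sqDeriv_X, this]
    simp

theorem twist_pow_char {p : ℕ} (hp : p.Prime) [CharP k p] (m : ℕ) :
    twist n (m : k) ^ p = 0 := by
  refine LinearMap.ext fun f => mul_left_cancel₀ (pow_ne_zero m (prod_X_ne_zero (k := k))) ?_
  have := twist_pow_prod_X_mul m (0 : k) p f
  rw [zero_add] at this
  rw [← this, twist_zero_pow_apply, iterate_char_sqDeriv hp]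
  simp

theorem rename_sqDeriv (σ : Equiv.Perm (Fin n)) (f : MvPolynomial (Fin n) k) :
    rename σ (sqDeriv k n f) = sqDeriv k n (rename σ f) := by
  induction f using MvPolynomial.induction_on with
  | C a => simp [← algebraMap_eq]
  | add f g hf hg => simp only [map_add, hf, hg]
  | mul_X f i hf => simp [sqDeriv_X, hf]

theorem rename_sum_X (σ : Equiv.Perm (Fin n)) :
    rename σ (∑ i, X i : MvPolynomial (Fin n) k) = ∑ i, X i := by
  simp only [map_sum, rename_X]
  exact Equiv.sum_comp σ fun i => (X i : MvPolynomial (Fin n) k)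

theorem rename_prod_X (σ : Equiv.Perm (Fin n)) :
    rename σ (∏ i, X i : MvPolynomial (Fin n) k) = ∏ i, X i := by
  simp only [map_prod, rename_X]
  exact Equiv.prod_comp σ fun i => (X i : MvPolynomial (Fin n) k)

theorem isSymmetric_twist (a : k) {f : MvPolynomial (Fin n) k} (hf : f.IsSymmetric) :
    (twist n a f).IsSymmetric := fun σ => by
  rw [twist_apply, map_add, map_mul, map_mul, rename_sum_X, rename_sqDeriv, hf σ, rename_C]

theorem isSymmetric_twist_pow (a : k) (s : ℕ) {f : MvPolynomial (Fin n) k} (hf : f.IsSymmetric) :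
    ((twist n a ^ s) f).IsSymmetric := by
  induction s with
  | zero => simpa
  | succ s ih => rw [pow_succ', Module.End.mul_apply]; exact isSymmetric_twist a ih

theorem isSymmetric_of_mul {w f : MvPolynomial (Fin n) k} (hw : w ≠ 0) (hws : w.IsSymmetric)
    (h : (w * f).IsSymmetric) : f.IsSymmetric := fun σ =>
  mul_left_cancel₀ hw (by have := h σ; rwa [map_mul, hws σ] at this)

theorem isSymmetric_prod_X : (∏ i, X i : MvPolynomial (Fin n) k).IsSymmetric := rename_prod_X

theorem sqDeriv_esymm (j : ℕ) :
    sqDeriv k n (esymm (Fin n) k j) =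
      esymm (Fin n) k 1 * esymm (Fin n) k j - (j + 1) * esymm (Fin n) k (j + 1) := by
  rw [esymm_one, esymm_eq_multiset_esymm, map_multiset_esymm]
  · rfl
  · simp [sqDeriv_X]

end Twist

section Restriction

variable {k : Type*} [Field k] {n : ℕ}

/-- Setting the last variable to zero. -/
noncomputable def killLast (k : Type*) [Field k] (n : ℕ) :
    MvPolynomial (Fin (n + 1)) k →ₐ[k] MvPolynomial (Fin n) k :=
  aeval (Fin.snoc (α := fun _ => MvPolynomial (Fin n) k) X 0)

theorem killLast_X_castSucc (i : Fin n) : killLast k n (X i.castSucc) = X i := by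
  simp [killLast]

theorem killLast_X_last : killLast k n (X (Fin.last n)) = 0 := by
  simp [killLast]

theorem killLast_sqDeriv (f : MvPolynomial (Fin (n + 1)) k) :
    killLast k n (sqDeriv k (n + 1) f) = sqDeriv k n (killLast k n f) := by
  induction f using MvPolynomial.induction_on with
  | C a => simp [← algebraMap_eq]
  | add f g hf hg => simp only [map_add, hf, hg]
  | mul_X f i hf =>
    rw [Derivation.leibniz, map_add, map_mul, Derivation.leibniz, sqDeriv_X]
    simp only [smul_eq_mul, map_mul, hf, map_pow]
    congr 2
    cases i using Fin.lastCases with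
    | last => simp [killLast_X_last]
    | cast i => simp [killLast_X_castSucc, sqDeriv_X]

theorem killLast_twist_pow (a : k) (s : ℕ) (f : MvPolynomial (Fin (n + 1)) k) :
    killLast k n ((twist (n + 1) a ^ s) f) = (twist n a ^ s) (killLast k n f) := by
  induction s with
  | zero => simp
  | succ s ih =>
    rw [pow_succ', Module.End.mul_apply, pow_succ', Module.End.mul_apply, ← ih, twist_apply,
      twist_apply, map_add, killLast_sqDeriv, Fin.sum_univ_castSucc]
    simp only [map_mul, map_add, map_sum, killLast_X_castSucc, killLast_X_last, add_zero]
    simp [killLast]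

theorem killLast_esymm (j : ℕ) :
    killLast k n (esymm (Fin (n + 1)) k j) = esymm (Fin n) k j := by
  have h : (Finset.univ.val.map
      (Fin.snoc (α := fun _ => MvPolynomial (Fin n) k) X 0 : Fin (n + 1) → _)) =
      0 ::ₘ Finset.univ.val.map X := by
    rw [Fin.univ_castSuccEmb]
    simp [Function.comp_def]
  rw [killLast, aeval_esymm_eq_multiset_esymm, h, esymm_eq_multiset_esymm]
  cases j with
  | zero => simp [multiset_esymm_zero]
  | succ j => rw [multiset_esymm_cons_succ, zero_mul, add_zero]

theorem isSymmetric_killLast {f : MvPolynomial (Fin (n + 1)) k} (hf : f.IsSymmetric) :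
    (killLast k n f).IsSymmetric := by
  obtain ⟨P, hP⟩ := (esymmAlgHom_fin_bijective k (n + 1)).2 ⟨f, hf⟩
  have hP' : aeval (fun i : Fin (n + 1) => esymm (Fin (n + 1)) k (i + 1)) P = f := by
    rw [← esymmAlgHom_apply, hP]
  rw [← hP', ← AlgHom.comp_apply, comp_aeval]
  simp only [killLast_esymm]
  rw [← esymmAlgHom_apply]
  exact (esymmAlgHom (Fin n) k (n + 1) P).2

theorem exists_isSymmetric_killLast_eq {f : MvPolynomial (Fin n) k} (hf : f.IsSymmetric) :
    ∃ g : MvPolynomial (Fin (n + 1)) k, g.IsSymmetric ∧ killLast k n g = f := by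
  obtain ⟨P, hP⟩ := (esymmAlgHom_fin_bijective k n).2 ⟨f, hf⟩
  refine ⟨esymmAlgHom (Fin (n + 1)) k n P, (esymmAlgHom (Fin (n + 1)) k n P).2, ?_⟩
  rw [esymmAlgHom_apply, ← AlgHom.comp_apply, comp_aeval]
  simp only [killLast_esymm]
  rw [← esymmAlgHom_apply, hP]

theorem X_last_dvd_of_killLast_eq_zero {f : MvPolynomial (Fin (n + 1)) k}
    (h : killLast k n f = 0) : X (Fin.last n) ∣ f := by
  have key : ∀ g : MvPolynomial (Fin (n + 1)) k,
      X (Fin.last n) ∣ g - rename Fin.castSucc (killLast k n g) := by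
    intro g
    induction g using MvPolynomial.induction_on with
    | C a => simp [killLast]
    | add g₁ g₂ h₁ h₂ =>
      rw [map_add, map_add, add_sub_add_comm]
      exact dvd_add h₁ h₂
    | mul_X g i hg =>
      cases i using Fin.lastCases with
      | last => simp [killLast_X_last]
      | cast i =>
        rw [map_mul, map_mul, killLast_X_castSucc, rename_X, ← sub_mul]
        exact hg.mul_right _
  simpa [h] using key f

theorem exists_eq_prod_X_mul_of_killLast_eq_zero {f : MvPolynomial (Fin (n + 1)) k}
    (hf : f.IsSymmetric) (h : killLast k n f = 0) :
    ∃ g : MvPolynomial (Fin (n + 1)) k, g.IsSymmetric ∧ f = (∏ i, X i) * g := by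
  have hX : ∀ i : Fin (n + 1), X i ∣ f := fun i => by
    have := map_dvd (rename (Equiv.swap (Fin.last n) i)) (X_last_dvd_of_killLast_eq_zero h)
    rwa [hf, rename_X, Equiv.swap_apply_left] at this
  obtain ⟨g, hg⟩ : (∏ i, X i) ∣ f := Fintype.prod_dvd_of_isRelPrime (fun i j hij => by
    have hi : Irreducible (X i : MvPolynomial (Fin (n + 1)) k) := X_prime.irreducible
    refine hi.isRelPrime_iff_not_dvd.2 fun hd => hij (X_dvd_X.1 hd)) hX
  exact ⟨g, isSymmetric_of_mul prod_X_ne_zero isSymmetric_prod_X (hg ▸ hf), hg⟩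

end Restriction

section Alternating

variable {k : Type*} [Field k] {n : ℕ}

/-- The linear operator dividing by `X i` the monomials that are divisible by `X i`, and sending
all other monomials to zero. -/
noncomputable def divX (i : Fin n) : Module.End k (MvPolynomial (Fin n) k) where
  toFun f := f.divMonomial (Finsupp.single i 1)
  map_add' f g := add_divMonomial f g _
  map_smul' a f := by ext m; simp [coeff_divMonomial]

theorem divX_X_mul (i : Fin n) (f : MvPolynomial (Fin n) k) : divX i (X i * f) = f :=
  X_mul_divMonomial i f

theorem divX_C (i : Fin n) (a : k) : divX i (C a : MvPolynomial (Fin n) k) = 0 := by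
  ext m
  have : (0 : Fin n →₀ ℕ) ≠ Finsupp.single i 1 + m := fun h => by
    have := DFunLike.congr_fun h i
    simp only [Finsupp.coe_zero, Pi.zero_apply, Finsupp.add_apply, Finsupp.single_eq_same] at this
    omega
  simp [divX, coeff_divMonomial, coeff_C, this]

theorem divX_X_mul_of_ne {i j : Fin n} (hij : i ≠ j) (f : MvPolynomial (Fin n) k) :
    divX i (X j * f) = X j * divX i f := by
  ext m
  simp only [divX, LinearMap.coe_mk, AddHom.coe_mk, coeff_divMonomial, coeff_X_mul']
  have hmem : j ∈ (Finsupp.single i 1 + m).support ↔ j ∈ m.support := by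
    simp [hij]
  by_cases hj : j ∈ m.support
  · rw [if_pos hj, if_pos (hmem.2 hj), add_tsub_assoc_of_le]
    rw [Finsupp.single_le_iff]
    exact Nat.one_le_iff_ne_zero.2 (Finsupp.mem_support_iff.1 hj)
  · rw [if_neg hj, if_neg (hj ∘ hmem.1)]

theorem divX_X_mul_eq (i j : Fin n) (f : MvPolynomial (Fin n) k) :
    divX i (X j * f) = if i = j then f else X j * divX i f := by
  split_ifs with h
  · rw [h, divX_X_mul]
  · exact divX_X_mul_of_ne h f

theorem rename_divX (σ : Equiv.Perm (Fin n)) (i : Fin n) (f : MvPolynomial (Fin n) k) :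
    rename σ (divX i f) = divX (σ i) (rename σ f) := by
  induction f using MvPolynomial.induction_on with
  | C a => simp [divX_C]
  | add f g hf hg => simp only [map_add, hf, hg]
  | mul_X f j hf =>
    rw [mul_comm, map_mul (rename σ), rename_X, divX_X_mul_eq, divX_X_mul_eq]
    simp only [EmbeddingLike.apply_eq_iff_eq]
    split_ifs
    · rfl
    · rw [map_mul, hf, rename_X]

theorem twist_one_divX (i : Fin n) (f : MvPolynomial (Fin n) k) :
    twist n 1 (divX i f) = divX i (twist n 1 f) - f := by
  have hX (j : Fin n) (g : MvPolynomial (Fin n) k) :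
      twist n 1 (X j * g) = X j * twist n 1 g + X j * (X j * g) := by
    simp only [twist_apply, Derivation.leibniz, sqDeriv_X, smul_eq_mul]
    ring
  induction f using MvPolynomial.induction_on with
  | C a =>
    have : twist n 1 (C a : MvPolynomial (Fin n) k) = ∑ j, X j * C a := by
      rw [twist_apply, ← algebraMap_eq, Derivation.map_algebraMap, ← Finset.sum_mul]
      simp
    rw [this, map_sum, divX_C]
    simp only [divX_X_mul_eq, divX_C]
    simp
  | add f g hf hg => simp only [map_add, hf, hg]; ring
  | mul_X f j hf =>
    rw [mul_comm f, hX, map_add]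
    by_cases hij : i = j
    · subst hij
      rw [divX_X_mul, divX_X_mul, divX_X_mul]
      ring
    · rw [divX_X_mul_of_ne hij, hX, divX_X_mul_of_ne hij, divX_X_mul_of_ne hij,
        divX_X_mul_of_ne hij, hf]
      ring

/-- The Vandermonde product `∏_{i < j} (X j - X i)`. -/
noncomputable def vandermondeProd (k : Type*) [Field k] (n : ℕ) : MvPolynomial (Fin n) k :=
  ∏ ij ∈ Finset.univ.sigma fun i : Fin n => Finset.Ioi i, (X ij.2 - X ij.1)

theorem vandermondeProd_eq_det :
    vandermondeProd k n = (Matrix.vandermonde (X : Fin n → MvPolynomial (Fin n) k)).det := by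
  rw [Matrix.det_vandermonde, vandermondeProd, Finset.prod_sigma]

theorem rename_vandermondeProd (σ : Equiv.Perm (Fin n)) :
    rename σ (vandermondeProd k n) = (Equiv.Perm.sign σ : ℤ) * vandermondeProd k n := by
  rw [vandermondeProd_eq_det, ← Matrix.det_permute, AlgHom.map_det]
  congr 1
  ext i j
  simp [Matrix.vandermonde]

theorem X_sub_X_ne_zero {i j : Fin n} (hij : i ≠ j) :
    (X i - X j : MvPolynomial (Fin n) k) ≠ 0 :=
  sub_ne_zero.2 fun h => hij (X_injective h)

theorem vandermondeProd_ne_zero : vandermondeProd k n ≠ 0 :=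
  Finset.prod_ne_zero_iff.2 fun ij hij =>
    X_sub_X_ne_zero (by simpa using (Finset.mem_Ioi.1 (Finset.mem_sigma.1 hij).2).ne')

theorem X_sub_X_dvd_vandermondeProd {i j : Fin n} (hij : i ≠ j) :
    X i - X j ∣ vandermondeProd k n := by
  rcases hij.lt_or_gt with h | h
  · rw [← neg_sub, neg_dvd]
    exact Finset.dvd_prod_of_mem (fun ij : Σ _ : Fin n, Fin n => X ij.2 - X ij.1)
      (a := ⟨i, j⟩) (by simpa using h)
  · exact Finset.dvd_prod_of_mem (fun ij : Σ _ : Fin n, Fin n => X ij.2 - X ij.1)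
      (a := ⟨j, i⟩) (by simpa using h)

theorem irreducible_X_sub_X {i j : Fin n} (hij : i ≠ j) :
    Irreducible (X i - X j : MvPolynomial (Fin n) k) := by
  have hc : coeff (Finsupp.single i 1) (X i - X j : MvPolynomial (Fin n) k) = 1 := by
    have : Finsupp.single j 1 ≠ (Finsupp.single i 1 : Fin n →₀ ℕ) := fun h =>
      hij (Finsupp.single_left_injective one_ne_zero h).symm
    simp [coeff_X, this]
  refine irreducible_of_totalDegree_eq_one (le_antisymm ?_ ?_) fun x hx =>
    isUnit_of_dvd_one (hc ▸ hx _)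
  · exact (totalDegree_sub _ _).trans (by simp)
  · have := le_totalDegree (p := (X i - X j : MvPolynomial (Fin n) k)) (s := Finsupp.single i 1)
      (by rw [mem_support_iff, hc]; exact one_ne_zero)
    simpa using this

theorem X_sub_X_dvd_sub_rename_swap (i j : Fin n) (f : MvPolynomial (Fin n) k) :
    X i - X j ∣ f - rename (Equiv.swap i j) f := by
  induction f using MvPolynomial.induction_on with
  | C a => simp
  | add f g hf hg => rw [map_add, add_sub_add_comm]; exact dvd_add hf hg
  | mul_X f l hf =>
    have hl : X i - X j ∣ (X l - X (Equiv.swap i j l) : MvPolynomial (Fin n) k) := by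
      rw [Equiv.swap_apply_def]
      split_ifs with h₁ h₂
      · rw [h₁]
      · rw [h₂, ← neg_sub, neg_dvd]
      · simp
    rw [map_mul, rename_X]
    obtain ⟨a, ha⟩ := hf
    obtain ⟨b, hb⟩ := hl
    exact ⟨a * X l + rename (Equiv.swap i j) f * b, by
      linear_combination X l * ha + rename (Equiv.swap i j) f * hb⟩

theorem vandermondeProd_dvd {f : MvPolynomial (Fin n) k}
    (h : ∀ i j : Fin n, i ≠ j → X i - X j ∣ f) : vandermondeProd k n ∣ f := by
  refine Finset.prod_dvd_of_isRelPrime ?_ ?_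
  · rintro ⟨i, j⟩ hij ⟨i', j'⟩ hij' hne
    have hij : i < j := by simpa using hij
    have hij' : i' < j' := by simpa using hij'
    refine (irreducible_X_sub_X hij.ne').isRelPrime_iff_not_dvd.2 fun hd => ?_
    have h0 := map_dvd (aeval (R := k) fun l => if l = j then X i else X l :
      MvPolynomial (Fin n) k →ₐ[k] MvPolynomial (Fin n) k) hd
    simp only [map_sub, aeval_X, if_true, hij.ne, if_false, sub_self, zero_dvd_iff] at h0
    rw [sub_eq_zero] at h0
    apply hne
    split_ifs at h0 with h₁ h₂ h₂
    · exact absurd (h₁.trans h₂.symm) hij'.ne'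
    · rw [h₁, X_injective h0]
    · rw [h₂, X_injective h0] at hij'
      exact absurd hij hij'.asymm
    · exact absurd (X_injective h0) hij'.ne'
  · rintro ⟨i, j⟩ hij
    exact h _ _ (by simpa using (Finset.mem_Ioi.1 (Finset.mem_sigma.1 hij).2).ne')

theorem sqDeriv_vandermondeProd :
    sqDeriv k n (vandermondeProd k n) = C ((n : k) - 1) * (∑ i, X i) * vandermondeProd k n := by
  rw [vandermondeProd, map_prod_eq_sum_mul_prod _ _ _ (fun ij => X ij.1 + X ij.2)]
  · congr 1
    rw [Finset.sum_sigma]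
    have h (f : Fin n → MvPolynomial (Fin n) k) :
        ∑ i, ∑ j ∈ Finset.Ioi i, (f i + f j) = ((n : MvPolynomial (Fin n) k) - 1) * ∑ i, f i := by
      have h₁ : ∑ i, ∑ j ∈ Finset.Ioi i, f j = ∑ i, ∑ j ∈ Finset.Iio i, f i :=
        Finset.sum_comm' (by simp)
      simp only [Finset.sum_add_distrib, h₁]
      rw [← Finset.sum_add_distrib, Finset.mul_sum]
      refine Finset.sum_congr rfl fun i _ => ?_
      have hi : ((n - 1 - i : ℕ) : MvPolynomial (Fin n) k) + (i : ℕ) = n - 1 := by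
        have := i.2
        rw [← Nat.cast_add, show n - 1 - i + i = n - 1 by omega, Nat.cast_sub (by omega),
          Nat.cast_one]
      simp only [Finset.sum_const, Fin.card_Ioi, Fin.card_Iio, nsmul_eq_mul, ← add_mul, hi]
    rw [h]
    simp
  · intro ij _
    simp only [map_sub, sqDeriv_X]
    ring

/-- The space of multiples of the Vandermonde product by symmetric polynomials. -/
noncomputable def alternants (k : Type*) [Field k] (n : ℕ) :
    Submodule k (MvPolynomial (Fin n) k) :=
  (Subalgebra.toSubmodule (symmetricSubalgebra (Fin n) k)).map
    (LinearMap.mulLeft k (vandermondeProd k n))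

theorem mem_alternants {F : MvPolynomial (Fin n) k} :
    F ∈ alternants k n ↔
      ∃ f : MvPolynomial (Fin n) k, f.IsSymmetric ∧ vandermondeProd k n * f = F := by
  simp [alternants]

theorem mem_alternants_iff {F : MvPolynomial (Fin n) k} :
    F ∈ alternants k n ↔ (∀ σ : Equiv.Perm (Fin n), rename σ F = (Equiv.Perm.sign σ : ℤ) * F) ∧
      ∀ i j : Fin n, i ≠ j → X i - X j ∣ F := by
  rw [mem_alternants]
  constructor
  · rintro ⟨f, hf, rfl⟩
    refine ⟨fun σ => ?_, fun i j hij => (X_sub_X_dvd_vandermondeProd hij).mul_right f⟩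
    rw [map_mul, rename_vandermondeProd, hf σ, mul_assoc]
  · rintro ⟨h, hd⟩
    obtain ⟨f, rfl⟩ := vandermondeProd_dvd hd
    refine ⟨f, fun σ => ?_, rfl⟩
    have hs := h σ
    rw [map_mul, rename_vandermondeProd, mul_assoc] at hs
    rcases Int.units_eq_one_or (Equiv.Perm.sign σ) with h1 | h1 <;>
      simpa [h1, vandermondeProd_ne_zero] using hs

theorem sum_divX_mem_alternants {F : MvPolynomial (Fin n) k} (hF : F ∈ alternants k n) :
    ∑ i, divX i F ∈ alternants k n := by
  rw [mem_alternants_iff] at hF ⊢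
  obtain ⟨hF, hd⟩ := hF
  have hint (i : Fin n) (m : ℤ) (f : MvPolynomial (Fin n) k) :
      divX i ((m : MvPolynomial (Fin n) k) * f) = m * divX i f := by
    rw [← zsmul_eq_mul, map_zsmul, zsmul_eq_mul]
  refine ⟨fun σ => ?_, fun i j hij => ?_⟩
  · simp only [map_sum, rename_divX, hF, hint, Finset.mul_sum]
    exact Equiv.sum_comp σ fun i => ((Equiv.Perm.sign σ : ℤ) : MvPolynomial (Fin n) k) * divX i F
  · obtain ⟨Q, rfl⟩ := hd i j hij
    have hQ : rename (Equiv.swap i j) Q = Q := by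
      have := hF (Equiv.swap i j)
      rw [map_mul, map_sub, rename_X, rename_X, Equiv.swap_apply_left, Equiv.swap_apply_right,
        Equiv.Perm.sign_swap hij] at this
      refine mul_left_cancel₀ (X_sub_X_ne_zero hij.symm) (this.trans ?_)
      push_cast
      ring
    rw [← Finset.add_sum_erase _ _ (Finset.mem_univ i), ← Finset.add_sum_erase _ _
      (Finset.mem_erase.2 ⟨hij.symm, Finset.mem_univ j⟩), ← add_assoc]
    refine dvd_add ?_ (Finset.dvd_sum fun l hl => ?_)
    · obtain ⟨R, hR⟩ := X_sub_X_dvd_sub_rename_swap i j (divX i Q)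
      rw [rename_divX, hQ, Equiv.swap_apply_left] at hR
      simp only [sub_mul, map_sub, divX_X_mul_eq, hij, hij.symm, if_true, if_false]
      exact ⟨divX j Q - X j * R, by linear_combination (-X j) * hR⟩
    · simp only [Finset.mem_erase] at hl
      rw [sub_mul, map_sub, divX_X_mul_of_ne hl.2.1, divX_X_mul_of_ne hl.1, ← sub_mul]
      exact dvd_mul_right _ _

theorem twist_pow_vandermondeProd_mul (s : ℕ) (f : MvPolynomial (Fin n) k) :
    (twist n 1 ^ s) (vandermondeProd k n * f) = vandermondeProd k n * (twist n (n : k) ^ s) f := by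
  rw [twist_pow_mul sqDeriv_vandermondeProd, add_sub_cancel]

end Alternating

section Acyclic

variable {k : Type*} [Field k] {n : ℕ}

/-- The `p`-complex of symmetric polynomials with differential `∂ + a e_1` has no cohomology. -/
def IsAcyclic (p n : ℕ) (a : k) : Prop :=
  ∀ s < p, ∀ f : MvPolynomial (Fin n) k, f.IsSymmetric → (twist n a ^ s) f = 0 →
    ∃ h : MvPolynomial (Fin n) k, h.IsSymmetric ∧ f = (twist n a ^ (p - s)) h

theorem isAcyclic_natCast {p : ℕ} (hp : p.Prime) [CharP k p] (hn : (n : k) ≠ 0) :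
    IsAcyclic p n (n : k) := by
  intro s hs f hf hsf
  have hmem : vandermondeProd k n * f ∈ alternants k n := mem_alternants.2 ⟨f, hf, rfl⟩
  obtain ⟨H, hH, e⟩ := exists_eq_pow_apply_of_weyl hp (twist n 1)
    (-(n : k)⁻¹ • ∑ i, divX i) (alternants k n) (fun x hx => by
      obtain ⟨g, hg, rfl⟩ := mem_alternants.1 hx
      have := twist_pow_vandermondeProd_mul 1 g
      rw [pow_one, pow_one] at this
      rw [this]
      exact mem_alternants.2 ⟨_, isSymmetric_twist _ hg, rfl⟩)
    (fun x hx => by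
      rw [LinearMap.smul_apply, LinearMap.sum_apply]
      exact Submodule.smul_mem _ _ (sum_divX_mem_alternants hx))
    (fun x _ => by
      simp only [LinearMap.smul_apply, LinearMap.sum_apply, map_smul, map_sum, twist_one_divX,
        Finset.sum_sub_distrib, Finset.sum_const, Finset.card_univ, Fintype.card_fin, smul_sub]
      rw [← Nat.cast_smul_eq_nsmul k, smul_smul, neg_mul, inv_mul_cancel₀ hn]
      module) hs hmem
    (by rw [twist_pow_vandermondeProd_mul, hsf, mul_zero])
  obtain ⟨h, hh, rfl⟩ := mem_alternants.1 hH
  refine ⟨h, hh, mul_left_cancel₀ vandermondeProd_ne_zero ?_⟩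
  rw [e, twist_pow_vandermondeProd_mul]

/-- If the restriction to `x_n = 0` of a cocycle is a coboundary, then the cocycle is cohomologous
to a multiple of `e_{n+1}`. -/
theorem exists_eq_add_prod_X_mul {p : ℕ} (hp : p.Prime) [CharP k p] (a : ℕ) {s : ℕ} (hs : s < p)
    {f : MvPolynomial (Fin (n + 1)) k} (hf : f.IsSymmetric)
    (hsf : (twist (n + 1) (a : k) ^ s) f = 0) {h₀ : MvPolynomial (Fin n) k}
    (hh₀ : h₀.IsSymmetric) (e : killLast k n f = (twist n (a : k) ^ (p - s)) h₀) :
    ∃ h f' : MvPolynomial (Fin (n + 1)) k, h.IsSymmetric ∧ f'.IsSymmetric ∧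
      (twist (n + 1) ((a + 1 : ℕ) : k) ^ s) f' = 0 ∧
      f = (twist (n + 1) (a : k) ^ (p - s)) h + (∏ i, X i) * f' := by
  obtain ⟨h, hh, rfl⟩ := exists_isSymmetric_killLast_eq hh₀
  obtain ⟨f', hf', e'⟩ := exists_eq_prod_X_mul_of_killLast_eq_zero
    (hf.sub (isSymmetric_twist_pow (a : k) (p - s) hh))
    (by rw [map_sub, e, killLast_twist_pow, sub_self])
  refine ⟨h, f', hh, hf', ?_, by rw [← e', add_sub_cancel]⟩
  refine mul_left_cancel₀ (prod_X_ne_zero (k := k)) ?_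
  have := twist_pow_prod_X_mul 1 (a : k) s f'
  rw [pow_one] at this
  push_cast at this ⊢
  rw [← this, ← e', map_sub, hsf, ← Module.End.mul_apply, ← pow_add, Nat.add_sub_cancel' hs.le,
    twist_pow_char hp]
  simp

theorem twist_pow_prod_X_mul_one (a : ℕ) (s : ℕ) (f : MvPolynomial (Fin n) k) :
    (twist n (a : k) ^ s) ((∏ i, X i) * f) =
      (∏ i, X i) * (twist n ((a + 1 : ℕ) : k) ^ s) f := by
  simpa using twist_pow_prod_X_mul 1 (a : k) s f

theorem isAcyclic_of_restrict {p : ℕ} (hp : p.Prime) [CharP k p] (a : ℕ)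
    (h₁ : IsAcyclic p (n + 1) ((a + 1 : ℕ) : k)) (h₂ : IsAcyclic p n (a : k)) :
    IsAcyclic p (n + 1) (a : k) := by
  intro s hs f hf hsf
  obtain ⟨h₀, hh₀, e₀⟩ := h₂ s hs (killLast k n f) (isSymmetric_killLast hf)
    (by rw [← killLast_twist_pow, hsf, map_zero])
  obtain ⟨h, f', hh, hf', hsf', e⟩ := exists_eq_add_prod_X_mul hp a hs hf hsf hh₀ e₀
  obtain ⟨h', hh', e'⟩ := h₁ s hs f' hf' hsf'
  refine ⟨h + (∏ i, X i) * h', hh.add (isSymmetric_prod_X.mul hh'), ?_⟩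
  rw [map_add, twist_pow_prod_X_mul_one, ← e', ← e]

theorem isAcyclic_of_pos_of_le {p : ℕ} (hp : p.Prime) [CharP k p] {a : ℕ} (ha : 0 < a)
    (han : a ≤ n % p) : IsAcyclic p n (a : k) := by
  obtain ⟨g, hg⟩ := Nat.exists_eq_add_of_le han
  have hlt := Nat.mod_lt n hp.pos
  induction g generalizing n a with
  | zero =>
    have hcast : (a : k) = (n : k) := by
      rw [add_zero] at hg
      rw [← hg, ← CharP.cast_eq_mod k p]
    rw [hcast]
    refine isAcyclic_natCast hp fun h => ?_
    have := Nat.mod_eq_zero_of_dvd ((CharP.cast_eq_zero_iff k p n).1 h)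
    omega
  | succ g ih =>
    obtain ⟨n, rfl⟩ : ∃ m, n = m + 1 := Nat.exists_eq_succ_of_ne_zero (by rintro rfl; simp at hg)
    have hmod : n % p = a + g := by
      have hdiv := Nat.div_add_mod (n + 1) p
      rw [show n = p * ((n + 1) / p) + (a + g) by omega, Nat.mul_add_mod,
        Nat.mod_eq_of_lt (by omega)]
    exact isAcyclic_of_restrict hp a (ih (by omega) (by omega) (by omega) hlt)
      (ih ha (by omega) hmod (by omega))

end Acyclic

section Homogeneous

variable {k : Type*} [Field k] {n : ℕ}

theorem homogeneousComponent_apply_of_raises (L : Module.End k (MvPolynomial (Fin n) k)) (m : ℕ)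
    (hL : ∀ (f : MvPolynomial (Fin n) k) (d : ℕ), f.IsHomogeneous d → (L f).IsHomogeneous (d + m))
    (d : ℕ) (f : MvPolynomial (Fin n) k) :
    homogeneousComponent d (L f) =
      if m ≤ d then L (homogeneousComponent (d - m) f) else 0 := by
  induction f using MvPolynomial.induction_on' with
  | monomial u c =>
    have hu := isHomogeneous_monomial c (rfl : u.degree = u.degree)
    rw [homogeneousComponent_of_mem (hL _ _ hu), homogeneousComponent_of_mem hu]
    split_ifs <;> first | rfl | omega | simp
  | add f g hf hg =>
    simp only [map_add, hf, hg]
    split_ifs <;> simp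

theorem isHomogeneous_sqDeriv (f : MvPolynomial (Fin n) k) (d : ℕ) (hf : f.IsHomogeneous d) :
    (sqDeriv k n f).IsHomogeneous (d + 1) := by
  rw [f.as_sum, map_sum]
  refine IsHomogeneous.sum _ _ _ fun u hu => ?_
  rw [sqDeriv, mkDerivation_monomial, Finsupp.sum]
  refine (homogeneousSubmodule (Fin n) k (d + 1)).smul_mem _ (Submodule.sum_mem _ fun i hi => ?_)
  have hd : (u - Finsupp.single i 1).degree + 1 = d := by
    have h1 : Finsupp.single i 1 ≤ u := by
      rw [Finsupp.single_le_iff]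
      exact Nat.one_le_iff_ne_zero.2 (Finsupp.mem_support_iff.1 hi)
    have h2 := congrArg Finsupp.degree (tsub_add_cancel_of_le h1)
    rw [map_add, Finsupp.degree_single] at h2
    rw [h2]
    rw [Finsupp.degree_eq_weight_one]
    exact hf (mem_support_iff.1 hu)
  rw [smul_eq_mul]
  rw [← hd, add_assoc]
  exact (isHomogeneous_monomial _ rfl).mul ((isHomogeneous_X k i).pow 2)

theorem isHomogeneous_twist_zero_pow (s : ℕ) (f : MvPolynomial (Fin n) k) (d : ℕ)
    (hf : f.IsHomogeneous d) : ((twist n 0 ^ s) f).IsHomogeneous (d + s) := by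
  induction s with
  | zero => simpa
  | succ s ih =>
    rw [pow_succ', Module.End.mul_apply, twist_zero_apply, ← add_assoc]
    exact isHomogeneous_sqDeriv _ _ ih

theorem isSymmetric_homogeneousComponent (d : ℕ) {f : MvPolynomial (Fin n) k}
    (hf : f.IsSymmetric) : (homogeneousComponent d f).IsSymmetric := fun σ => by
  rw [rename_homogeneousComponent, hf σ]

theorem twist_zero_pow_homogeneousComponent {s : ℕ} {f : MvPolynomial (Fin n) k}
    (hf : (twist n 0 ^ s) f = 0) (d : ℕ) : (twist n 0 ^ s) (homogeneousComponent d f) = 0 := by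
  have := homogeneousComponent_apply_of_raises _ s (isHomogeneous_twist_zero_pow (k := k) (n := n)
    s) (d + s) f
  rw [hf, map_zero, if_pos (Nat.le_add_left s d), Nat.add_sub_cancel] at this
  exact this.symm

theorem esymm_card : esymm (Fin n) k n = ∏ i, X i := by
  have : Finset.powersetCard n (Finset.univ : Finset (Fin n)) = {Finset.univ} := by
    simpa using Finset.powersetCard_self (Finset.univ : Finset (Fin n))
  rw [esymm, this, Finset.sum_singleton]

theorem isHomogeneous_esymm (j : ℕ) : (esymm (Fin n) k j).IsHomogeneous j := by
  refine IsHomogeneous.sum _ _ _ fun t ht => ?_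
  have := IsHomogeneous.prod t (fun i => (X i : MvPolynomial (Fin n) k)) (fun _ => 1)
    fun i _ => isHomogeneous_X k i
  simpa [(Finset.mem_powersetCard.1 ht).2] using this

end Homogeneous

section Cohomology

variable {k : Type*} [Field k] {n : ℕ}

/-- The subalgebra generated by the `p`-th powers of the `e_{jp}` with `1 ≤ j` and `jp ≤ n`. -/
noncomputable def esymmPowAlgebra (k : Type*) [Field k] (p n : ℕ) :
    Subalgebra k (MvPolynomial (Fin n) k) :=
  Algebra.adjoin k {f | ∃ j : ℕ, 1 ≤ j ∧ j * p ≤ n ∧ f = esymm (Fin n) k (j * p) ^ p}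

theorem isSymmetric_of_mem_esymmPowAlgebra {p : ℕ} {g : MvPolynomial (Fin n) k}
    (hg : g ∈ esymmPowAlgebra k p n) : g.IsSymmetric := by
  have : esymmPowAlgebra k p n ≤ symmetricSubalgebra (Fin n) k := by
    refine Algebra.adjoin_le ?_
    rintro _ ⟨j, -, -, rfl⟩
    exact (symmetricSubalgebra (Fin n) k).pow_mem (esymm_isSymmetric (Fin n) k (j * p)) p
  exact this hg

theorem sqDeriv_of_mem_esymmPowAlgebra {p : ℕ} [CharP k p] {g : MvPolynomial (Fin n) k}
    (hg : g ∈ esymmPowAlgebra k p n) : sqDeriv k n g = 0 := by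
  induction hg using Algebra.adjoin_induction with
  | mem x hx =>
    obtain ⟨j, -, -, rfl⟩ := hx
    rw [Derivation.leibniz_pow, nsmul_eq_mul, CharP.cast_eq_zero, zero_mul]
  | algebraMap r => exact Derivation.map_algebraMap _ r
  | add x y _ _ hx hy => rw [map_add, hx, hy, add_zero]
  | mul x y _ _ hx hy => rw [Derivation.leibniz, hx, hy, smul_zero, smul_zero, add_zero]

theorem twist_zero_pow_of_mem_esymmPowAlgebra {p : ℕ} [CharP k p] {g : MvPolynomial (Fin n) k}
    (hg : g ∈ esymmPowAlgebra k p n) {s : ℕ} (hs : 1 ≤ s) : (twist n 0 ^ s) g = 0 := by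
  obtain ⟨s, rfl⟩ := Nat.exists_eq_add_of_le' hs
  rw [pow_succ, Module.End.mul_apply, twist_zero_apply, sqDeriv_of_mem_esymmPowAlgebra hg, map_zero]

theorem exists_mem_esymmPowAlgebra_killLast_eq {p : ℕ} {g : MvPolynomial (Fin n) k}
    (hg : g ∈ esymmPowAlgebra k p n) :
    ∃ g' ∈ esymmPowAlgebra k p (n + 1), killLast k n g' = g := by
  have : esymmPowAlgebra k p n ≤ (esymmPowAlgebra k p (n + 1)).map (killLast k n) := by
    refine Algebra.adjoin_le ?_
    rintro _ ⟨j, hj, hjn, rfl⟩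
    exact ⟨_, Algebra.subset_adjoin ⟨j, hj, by omega, rfl⟩, by simp [killLast_esymm]⟩
  exact this hg

theorem homogeneousComponent_mem_esymmPowAlgebra {p : ℕ} {g : MvPolynomial (Fin n) k}
    (hg : g ∈ esymmPowAlgebra k p n) (d : ℕ) :
    homogeneousComponent d g ∈ esymmPowAlgebra k p n := by
  rw [← Subalgebra.mem_toSubmodule, esymmPowAlgebra, Algebra.adjoin_eq_span] at hg
  induction hg using Submodule.span_induction with
  | mem x hx =>
    obtain ⟨e, he⟩ : ∃ e, x.IsHomogeneous e := by
      induction hx using Submonoid.closure_induction with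
      | mem x hx =>
        obtain ⟨j, -, -, rfl⟩ := hx
        exact ⟨_, (isHomogeneous_esymm (j * p)).pow p⟩
      | one => exact ⟨0, isHomogeneous_one _ _⟩
      | mul x y _ _ hx hy =>
        obtain ⟨a, ha⟩ := hx
        obtain ⟨b, hb⟩ := hy
        exact ⟨_, ha.mul hb⟩
    rw [homogeneousComponent_of_mem he]
    split_ifs
    · have hle : Submonoid.closure _ ≤ (esymmPowAlgebra k p n).toSubmonoid :=
        Submonoid.closure_le.2 Algebra.subset_adjoin
      exact hle hx
    · exact zero_mem _
  | zero => rw [map_zero]; exact zero_mem _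
  | add x y _ _ hx hy => rw [map_add]; exact add_mem hx hy
  | smul a x _ hx => rw [map_smul]; exact Subalgebra.smul_mem _ hx a

/-- The sum of `k[e_p^p, e_{2p}^p, …]` and the image of `∂ ^ m` on symmetric polynomials. -/
noncomputable def esymmPowAddImage (k : Type*) [Field k] (p n m : ℕ) :
    Submodule k (MvPolynomial (Fin n) k) :=
  Subalgebra.toSubmodule (esymmPowAlgebra k p n) ⊔
    (Subalgebra.toSubmodule (symmetricSubalgebra (Fin n) k)).map (twist n 0 ^ m)

theorem mem_esymmPowAddImage {p m : ℕ} {f : MvPolynomial (Fin n) k} :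
    f ∈ esymmPowAddImage k p n m ↔ ∃ g ∈ esymmPowAlgebra k p n,
      ∃ h : MvPolynomial (Fin n) k, h.IsSymmetric ∧ f = g + (twist n 0 ^ m) h := by
  simp [esymmPowAddImage, Submodule.mem_sup, eq_comm]

theorem homogeneousComponent_mem_esymmPowAddImage {p m : ℕ} {f : MvPolynomial (Fin n) k}
    (hf : f ∈ esymmPowAddImage k p n m) (d : ℕ) :
    homogeneousComponent d f ∈ esymmPowAddImage k p n m := by
  obtain ⟨g, hg, h, hh, rfl⟩ := mem_esymmPowAddImage.1 hf
  rw [map_add, homogeneousComponent_apply_of_raises _ m (isHomogeneous_twist_zero_pow m)]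
  refine mem_esymmPowAddImage.2 ⟨_, homogeneousComponent_mem_esymmPowAlgebra hg d, ?_⟩
  split_ifs
  · exact ⟨_, isSymmetric_homogeneousComponent (d - m) hh, rfl⟩
  · exact ⟨0, IsSymmetric.zero, by simp⟩

/-- Every class in the cohomology of the `p`-complex of symmetric polynomials is represented by
an element of `k[e_p^p, e_{2p}^p, …]`. -/
def IsGenerated (k : Type*) [Field k] (p n : ℕ) : Prop :=
  ∀ s, 1 ≤ s → s < p → ∀ f : MvPolynomial (Fin n) k, f.IsSymmetric → (twist n 0 ^ s) f = 0 →
    f ∈ esymmPowAddImage k p n (p - s)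

theorem IsGenerated.exists_eq_add_prod_X_mul {p : ℕ} (hp : p.Prime) [CharP k p]
    (H : IsGenerated k p n) {s : ℕ} (hs₁ : 1 ≤ s) (hs : s < p)
    {f : MvPolynomial (Fin (n + 1)) k} (hf : f.IsSymmetric) (hsf : (twist (n + 1) 0 ^ s) f = 0) :
    ∃ w ∈ esymmPowAddImage k p (n + 1) (p - s), ∃ f' : MvPolynomial (Fin (n + 1)) k,
      f'.IsSymmetric ∧ (twist (n + 1) ((1 : ℕ) : k) ^ s) f' = 0 ∧ f = w + (∏ i, X i) * f' := by
  obtain ⟨g₀, hg₀, h₀, hh₀, e₀⟩ := mem_esymmPowAddImage.1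
    (H s hs₁ hs _ (isSymmetric_killLast hf) (by rw [← killLast_twist_pow, hsf, map_zero]))
  obtain ⟨g, hg, rfl⟩ := exists_mem_esymmPowAlgebra_killLast_eq hg₀
  obtain ⟨h, f', hh, hf', hsf', e⟩ := SymmPComplex.exists_eq_add_prod_X_mul hp 0 hs
    (hf.sub (isSymmetric_of_mem_esymmPowAlgebra hg))
    (by rw [Nat.cast_zero, map_sub, hsf, twist_zero_pow_of_mem_esymmPowAlgebra hg hs₁, sub_zero])
    hh₀ (by rw [map_sub, e₀, Nat.cast_zero, add_sub_cancel_left])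
  rw [Nat.cast_zero] at e
  exact ⟨_, mem_esymmPowAddImage.2 ⟨g, hg, h, hh, rfl⟩, f', hf', by simpa using hsf', by
    linear_combination e⟩

theorem IsGenerated.succ_of_not_dvd {p : ℕ} (hp : p.Prime) [CharP k p] (H : IsGenerated k p n)
    (hn : ¬ p ∣ n + 1) : IsGenerated k p (n + 1) := by
  intro s hs₁ hs f hf hsf
  obtain ⟨w, hw, f', hf', hsf', rfl⟩ := H.exists_eq_add_prod_X_mul hp hs₁ hs hf hsf
  have hacyc : IsAcyclic p (n + 1) ((1 : ℕ) : k) := isAcyclic_of_pos_of_le hp one_pos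
    (Nat.one_le_iff_ne_zero.2 fun h => hn (Nat.dvd_of_mod_eq_zero h))
  obtain ⟨h, hh, rfl⟩ := hacyc s hs f' hf' hsf'
  refine add_mem hw (mem_esymmPowAddImage.2 ⟨0, zero_mem _, _, isSymmetric_prod_X.mul hh, ?_⟩)
  have := twist_pow_prod_X_mul_one (k := k) 0 (p - s) h
  rw [zero_add, ← this, Nat.cast_zero]

theorem exists_eq_add_prod_X_pow_mul {p : ℕ} (hp : p.Prime) [CharP k p] (hn : p ∣ n + 1)
    {s : ℕ} (hs : s < p) {f : MvPolynomial (Fin (n + 1)) k} (hf : f.IsSymmetric)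
    (hsf : (twist (n + 1) ((1 : ℕ) : k) ^ s) f = 0) (m : ℕ) (hm : m < p) :
    ∃ h f' : MvPolynomial (Fin (n + 1)) k, h.IsSymmetric ∧ f'.IsSymmetric ∧
      (twist (n + 1) ((1 + m : ℕ) : k) ^ s) f' = 0 ∧
      f = (twist (n + 1) ((1 : ℕ) : k) ^ (p - s)) h + (∏ i, X i) ^ m * f' := by
  have hmod : n % p = p - 1 := by
    obtain ⟨q, hq⟩ := hn
    obtain ⟨q, rfl⟩ : ∃ r, q = r + 1 :=
      Nat.exists_eq_succ_of_ne_zero (by rintro rfl; simp at hq)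
    have hpos := hp.pos
    rw [show n = p * q + (p - 1) by rw [mul_add] at hq; omega, Nat.mul_add_mod,
      Nat.mod_eq_of_lt (by omega)]
  induction m with
  | zero => exact ⟨0, f, IsSymmetric.zero, hf, by simpa using hsf, by simp⟩
  | succ m ih =>
    obtain ⟨h, f₁, hh, hf₁, hsf₁, e⟩ := ih (by omega)
    have hacyc : IsAcyclic p n ((1 + m : ℕ) : k) :=
      isAcyclic_of_pos_of_le hp (by omega) (by omega)
    obtain ⟨h₀, hh₀, e₀⟩ := hacyc s hs _ (isSymmetric_killLast hf₁)
      (by rw [← killLast_twist_pow, hsf₁, map_zero])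
    obtain ⟨h₁, f', hh₁, hf', hsf', e₁⟩ := exists_eq_add_prod_X_mul hp _ hs hf₁ hsf₁ hh₀ e₀
    refine ⟨h + (∏ i, X i) ^ m * h₁, f', hh.add
      (((symmetricSubalgebra _ k).pow_mem isSymmetric_prod_X m).mul hh₁), hf', hsf', ?_⟩
    rw [map_add, twist_pow_prod_X_mul, e, e₁]
    push_cast
    ring

theorem IsGenerated.succ_of_dvd {p : ℕ} (hp : p.Prime) [CharP k p] (H : IsGenerated k p n)
    (hn : p ∣ n + 1) : IsGenerated k p (n + 1) := by
  intro s hs₁ hs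
  have hmem : (∏ i, X i : MvPolynomial (Fin (n + 1)) k) ^ p ∈ esymmPowAlgebra k p (n + 1) := by
    obtain ⟨j, hj⟩ := hn
    refine Algebra.subset_adjoin ⟨j, Nat.one_le_iff_ne_zero.2 (by rintro rfl; simp at hj),
      by rw [hj, mul_comm], ?_⟩
    rw [mul_comm, ← hj, esymm_card]
  have hpmul (m : ℕ) (h : MvPolynomial (Fin (n + 1)) k) :
      (twist (n + 1) 0 ^ m) ((∏ i, X i) ^ p * h) = (∏ i, X i) ^ p * (twist (n + 1) 0 ^ m) h := by
    rw [twist_pow_prod_X_mul, CharP.cast_eq_zero, add_zero]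
  have hmul : ∀ w ∈ esymmPowAddImage k p (n + 1) (p - s),
      (∏ i, X i) ^ p * w ∈ esymmPowAddImage k p (n + 1) (p - s) := by
    intro w hw
    obtain ⟨g, hg, h, hh, rfl⟩ := mem_esymmPowAddImage.1 hw
    refine mem_esymmPowAddImage.2 ⟨_, mul_mem hmem hg, (∏ i, X i) ^ p * h,
      (isSymmetric_of_mem_esymmPowAlgebra hmem).mul hh, ?_⟩
    rw [hpmul, mul_add]
  have hred (f : MvPolynomial (Fin (n + 1)) k) (hf : f.IsSymmetric)
      (hsf : (twist (n + 1) 0 ^ s) f = 0) :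
      ∃ w ∈ esymmPowAddImage k p (n + 1) (p - s), ∃ f' : MvPolynomial (Fin (n + 1)) k,
        f'.IsSymmetric ∧ (twist (n + 1) 0 ^ s) f' = 0 ∧ f = w + (∏ i, X i) ^ p * f' := by
    obtain ⟨w, hw, f₁, hf₁, hsf₁, rfl⟩ := H.exists_eq_add_prod_X_mul hp hs₁ hs hf hsf
    obtain ⟨h, f', hh, hf', hsf', e⟩ :=
      exists_eq_add_prod_X_pow_mul hp hn hs hf₁ hsf₁ (p - 1) (Nat.sub_lt hp.pos one_pos)
    rw [Nat.add_sub_cancel' hp.one_le, CharP.cast_eq_zero] at hsf'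
    refine ⟨w + (twist (n + 1) 0 ^ (p - s)) ((∏ i, X i) * h), add_mem hw
      (mem_esymmPowAddImage.2 ⟨0, zero_mem _, _, isSymmetric_prod_X.mul hh, by simp⟩), f', hf',
      hsf', ?_⟩
    have h0 := twist_pow_prod_X_mul_one (k := k) 0 (p - s) h
    rw [Nat.cast_zero, zero_add] at h0
    rw [h0, e, ← Nat.succ_pred_eq_of_pos hp.pos, Nat.pred_eq_sub_one, pow_succ']
    simp only [Nat.succ_eq_add_one, Nat.add_sub_cancel]
    ring
  have hhom (d : ℕ) : ∀ f : MvPolynomial (Fin (n + 1)) k, f.IsSymmetric → f.IsHomogeneous d →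
      (twist (n + 1) 0 ^ s) f = 0 → f ∈ esymmPowAddImage k p (n + 1) (p - s) := by
    induction d using Nat.strong_induction_on with
    | _ d ih =>
      intro f hf hfd hsf
      obtain ⟨w, hw, f', hf', hsf', e⟩ := hred f hf hsf
      have hraise := homogeneousComponent_apply_of_raises
        (LinearMap.mulLeft k ((∏ i, X i : MvPolynomial (Fin (n + 1)) k) ^ p)) ((n + 1) * p)
        (fun g e hg => by
          have := ((isHomogeneous_esymm (k := k) (n := n + 1) (n + 1)).pow p).mul hg
          rwa [esymm_card, add_comm _ e] at this) d f'
      rw [← homogeneousComponent_eq_self hfd, e, map_add]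
      refine add_mem (homogeneousComponent_mem_esymmPowAddImage hw d) ?_
      rw [LinearMap.mulLeft_apply] at hraise
      rw [hraise]
      split_ifs with hd
      · have hpos : 0 < (n + 1) * p := Nat.mul_pos n.succ_pos hp.pos
        exact hmul _ (ih _ (by omega) _ (isSymmetric_homogeneousComponent _ hf')
          (homogeneousComponent_isHomogeneous _ _) (twist_zero_pow_homogeneousComponent hsf' _))
      · exact zero_mem _
  intro f hf hsf
  rw [← sum_homogeneousComponent f]
  exact Submodule.sum_mem _ fun d _ => hhom d _ (isSymmetric_homogeneousComponent d hf)
    (homogeneousComponent_isHomogeneous d f) (twist_zero_pow_homogeneousComponent hsf d)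

theorem isGenerated {p : ℕ} (hp : p.Prime) [CharP k p] (n : ℕ) : IsGenerated k p n := by
  induction n with
  | zero =>
    intro s _ _ f _ _
    refine mem_esymmPowAddImage.2 ⟨f, ?_, 0, IsSymmetric.zero, by simp⟩
    rw [eq_C_of_isEmpty f, ← algebraMap_eq]
    exact Subalgebra.algebraMap_mem _ _
  | succ n ih =>
    by_cases hn : p ∣ n + 1
    · exact ih.succ_of_dvd hp hn
    · exact ih.succ_of_not_dvd hp hn

/-- The image of `∂` on symmetric polynomials meets `k[e_p^p, e_{2p}^p, …]` trivially: both are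
compared with the quotient of `k[e_1, …, e_n]` by the `e_j` with `p ∤ j`. -/
theorem eq_zero_of_sqDeriv_mem_esymmPowAlgebra {p : ℕ} (hp : p.Prime) [CharP k p]
    {h : MvPolynomial (Fin n) k} (hh : h.IsSymmetric)
    (hmem : sqDeriv k n h ∈ esymmPowAlgebra k p n) : sqDeriv k n h = 0 := by
  classical
  let E : MvPolynomial (Fin n) k →ₐ[k] MvPolynomial (Fin n) k :=
    aeval fun i : Fin n => esymm (Fin n) k (i + 1)
  have hE : Function.Injective E := fun P Q hPQ =>
    (esymmAlgHom_fin_bijective k n).1 (Subtype.ext (by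
      rw [esymmAlgHom_apply, esymmAlgHom_apply]
      exact hPQ))
  let ψ : MvPolynomial (Fin n) k →ₐ[k] MvPolynomial (Fin n) k :=
    aeval fun i : Fin n => if p ∣ i + 1 then X i else 0
  have hEsymm (j : ℕ) (hj : ¬ p ∣ j) : ∃ P, E P = esymm (Fin n) k j ∧ ψ P = 0 := by
    obtain ⟨j, rfl⟩ := Nat.exists_eq_succ_of_ne_zero (fun h : j = 0 => hj (h ▸ dvd_zero p))
    by_cases hjn : j < n
    · exact ⟨X ⟨j, hjn⟩, by simp [E], by simpa [ψ] using hj⟩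
    · refine ⟨0, ?_, map_zero _⟩
      rw [map_zero, esymm, Finset.powersetCard_eq_empty.2 (by simpa using by omega),
        Finset.sum_empty]
  have hD (P : MvPolynomial (Fin n) k) : ∃ Q, E Q = sqDeriv k n (E P) ∧ ψ Q = 0 := by
    induction P using MvPolynomial.induction_on with
    | C a => exact ⟨0, by simp [← algebraMap_eq], map_zero _⟩
    | add P₁ P₂ h₁ h₂ =>
      obtain ⟨Q₁, e₁, h₁⟩ := h₁
      obtain ⟨Q₂, e₂, h₂⟩ := h₂
      exact ⟨Q₁ + Q₂, by simp [e₁, e₂], by simp [h₁, h₂]⟩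
    | mul_X P i hP =>
      obtain ⟨Q, e, h⟩ := hP
      obtain ⟨Q₁, e₁, h₁⟩ := hEsymm 1 hp.not_dvd_one
      obtain ⟨Q₂, e₂, h₂⟩ : ∃ Q₂, E Q₂ = ((i + 1 : ℕ) + 1) * esymm (Fin n) k (i + 1 + 1) ∧
          ψ Q₂ = 0 := by
        by_cases hi : p ∣ i + 1 + 1
        · have : (((i + 1 + 1 : ℕ) : ℕ) : MvPolynomial (Fin n) k) = 0 :=
            (CharP.cast_eq_zero_iff _ p _).2 hi
          push_cast at this ⊢
          exact ⟨0, by rw [this]; simp, map_zero _⟩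
        · obtain ⟨R, e, h⟩ := hEsymm _ hi
          exact ⟨((i + 1 : ℕ) + 1) * R, by simp [e], by simp [h]⟩
      refine ⟨Q * X i + P * (Q₁ * X i - Q₂), ?_, by simp [h, h₁, h₂]⟩
      have hXi : E (X i) = esymm (Fin n) k (i + 1) := aeval_X _ i
      rw [map_mul, Derivation.leibniz, hXi, sqDeriv_esymm, map_add, map_mul, map_mul, map_sub,
        map_mul, e, e₁, e₂, hXi, smul_eq_mul, smul_eq_mul]
      ring
  have hB {g : MvPolynomial (Fin n) k} (hg : g ∈ esymmPowAlgebra k p n) :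
      ∃ P, E P = g ∧ ψ P = P := by
    induction hg using Algebra.adjoin_induction with
    | mem x hx =>
      obtain ⟨j, hj, hjn, rfl⟩ := hx
      have hpos : 0 < j * p := Nat.mul_pos hj hp.pos
      refine ⟨X ⟨j * p - 1, by omega⟩ ^ p, ?_, ?_⟩
      · simp [E, Nat.sub_add_cancel hpos]
      · simp [ψ, Nat.sub_add_cancel hpos]
    | algebraMap r => exact ⟨C r, by simp [E], by simp [ψ]⟩
    | add x y _ _ hx hy =>
      obtain ⟨P, e, h⟩ := hx
      obtain ⟨P', e', h'⟩ := hy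
      exact ⟨P + P', by simp [e, e'], by simp [h, h']⟩
    | mul x y _ _ hx hy =>
      obtain ⟨P, e, h⟩ := hx
      obtain ⟨P', e', h'⟩ := hy
      exact ⟨P * P', by simp [e, e'], by simp [h, h']⟩
  obtain ⟨P, hP⟩ := (esymmAlgHom_fin_bijective k n).2 ⟨h, hh⟩
  have hP' : E P = h := by
    change aeval _ P = h
    rw [← esymmAlgHom_apply, hP]
  obtain ⟨Q, e, hQ⟩ := hD P
  obtain ⟨Q', e', hQ'⟩ := hB hmem
  rw [← e', ← hQ', hE (e'.trans ((congrArg _ hP').symm.trans e.symm)), hQ, map_zero]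

end Cohomology

end SymmPComplex

open SymmPComplex

/-- For `cp ≤ n ≤ (c+1)p − 1`, `n ≥ 1`, the inclusion of the subalgebra
`B_c = k[e_p^p, …, e_{cp}^p]` (with zero differential) into `Sym_n` is a
quasi-isomorphism of `p`-complexes. -/
theorem stmt10 (p : ℕ) (hp : p.Prime) (k : Type*) [Field k] [CharP k p]
    (c n : ℕ) (hcn : c * p ≤ n) (hnc : n ≤ (c + 1) * p - 1) (hn : 1 ≤ n)
    (D : Derivation k (MvPolynomial (Fin n) k) (MvPolynomial (Fin n) k))
    (hD : ∀ i, D (X i) = X i ^ 2)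
    (B : Subalgebra k (MvPolynomial (Fin n) k))
    (hB : B = Algebra.adjoin k
      {f | ∃ j : ℕ, 1 ≤ j ∧ j ≤ c ∧ f = esymm (Fin n) k (j * p) ^ p}) :
    ∀ s : ℕ, 1 ≤ s → s ≤ p - 1 →
      (∀ f : MvPolynomial (Fin n) k, f.IsSymmetric → (⇑D)^[s] f = 0 →
        ∃ g ∈ B, ∃ h : MvPolynomial (Fin n) k, h.IsSymmetric ∧ f = g + (⇑D)^[p - s] h) ∧
      (∀ g ∈ B, (∃ h : MvPolynomial (Fin n) k, h.IsSymmetric ∧ (⇑D)^[p - s] h = g) →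
        g = 0) := by
  have hDeq : D = sqDeriv k n := derivation_ext fun i => by rw [hD, sqDeriv_X]
  have hpos := hp.pos
  have hBeq : B = esymmPowAlgebra k p n := by
    rw [hB, esymmPowAlgebra]
    congr 1
    ext f
    refine exists_congr fun j => and_congr_right fun _ => and_congr_left fun _ => ?_
    refine ⟨fun hj => (Nat.mul_le_mul_right p hj).trans hcn, fun hj => ?_⟩
    have : 0 < (c + 1) * p := Nat.mul_pos c.succ_pos hpos
    exact Nat.lt_succ_iff.1 (lt_of_mul_lt_mul_right (by omega : j * p < (c + 1) * p) p.zero_le)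
  subst hDeq hBeq
  intro s hs₁ hs
  simp only [← twist_zero_pow_apply]
  refine ⟨fun f hf hsf => mem_esymmPowAddImage.1 (isGenerated hp n s hs₁ (by omega) f hf hsf), ?_⟩
  rintro _ hg ⟨h, hh, rfl⟩
  obtain ⟨m, hm⟩ : ∃ m, p - s = m + 1 := ⟨p - s - 1, by omega⟩
  rw [hm, pow_succ', Module.End.mul_apply, twist_zero_apply] at hg ⊢
  exact eq_zero_of_sqDeriv_mem_esymmPowAlgebra hp (isSymmetric_twist_pow 0 m hh) hg
end
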